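/- (Ordered removal lemma.) Let ℋ be a hereditary property of simple ordered graphs containing at least one graph on n vertices for every n ≥ 1, and fix ε, c > 0. Then there exists a positive integer k = k(ℋ, ε, c) such that for every simple ordered graph G on n ≥ k vertices with d₁(G, ℋ) ≥ ε, the probability that the induced ordered subgraph of G on a uniformly random k-element subset of its vertices does not belong to ℋ is at least 1 − c. -/

import Mathlib

open MeasureTheory Real Filter
open scoped ENNReal Classical

noncomputable section

/-- The unit interval `[0,1]` as a subtype of `ℝ`. -/
abbrev UI : Type := Set.Icc (0:ℝ) 1

/-- The unit square `[0,1]²`. -/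
abbrev USq : Type := UI × UI

/-- An orderon: a symmetric measurable function `([0,1]²)² → [0,1]`. -/
def IsOrderon (W : USq → USq → ℝ) : Prop :=
  Measurable (Function.uncurry W) ∧ (∀ u v, W u v ∈ Set.Icc (0:ℝ) 1) ∧
    ∀ u v, W u v = W v u

/-- The (unordered) cut norm: `sup_{S,T} |∫_{S×T} W|` over measurable `S,T ⊆ [0,1]²`. -/
def cutNorm (W : USq → USq → ℝ) : ℝ :=
  sSup {x | ∃ S T : Set USq, MeasurableSet S ∧ MeasurableSet T ∧
    x = |∫ p in S ×ˢ T, W p.1 p.2|}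

/-- The induced ordered subgraph of `G` on a `k`-element subset `S` of its vertices,
with the vertices of `S` relabeled by `[k]` in increasing order. -/
def inducedSG {n : ℕ} (G : SimpleGraph (Fin n)) (k : ℕ) (S : Finset (Fin n)) :
    SimpleGraph (Fin k) :=
  if h : S.card = k then G.comap (fun i => (S.orderIsoOfFin h i : Fin n)) else ⊥

/-- A property of simple ordered graphs (one set of graphs for each number of
vertices) is hereditary if it is closed under taking induced ordered subgraphs. -/
def Hereditary (H : ∀ n, Set (SimpleGraph (Fin n))) : Prop :=
  ∀ (n k : ℕ) (G : SimpleGraph (Fin n)), G ∈ H n → ∀ S : Finset (Fin n), S.card = k →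
    inducedSG G k S ∈ H k

/-- Normalized edit (Hamming) distance between two ordered graphs on `[n]`:
`|{(i,j) : G(i,j) ≠ G'(i,j)}| / n²`. -/
def editDist {n : ℕ} (G G' : SimpleGraph (Fin n)) : ℝ :=
  ((Finset.univ.filter
      (fun p : Fin n × Fin n => ¬ (G.Adj p.1 p.2 ↔ G'.Adj p.1 p.2))).card : ℝ) / (n^2 : ℝ)

/-- Distance of `G` from a set of ordered graphs on the same vertex set. -/
def distToProp {n : ℕ} (G : SimpleGraph (Fin n)) (P : Set (SimpleGraph (Fin n))) : ℝ :=
  sInf {x | ∃ G' ∈ P, x = editDist G G'}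

lemma distToProp_le {n : ℕ} {G F : SimpleGraph (Fin n)} {P : Set (SimpleGraph (Fin n))}
    (hF : F ∈ P) : distToProp G P ≤ editDist G F := by
  refine csInf_le ⟨0, ?_⟩ ⟨F, hF, rfl⟩
  rintro x ⟨G', -, rfl⟩
  unfold editDist
  positivity

/-- The subgraph of `G` induced on `S` belongs to the property `H`. -/
def InducedIn (H : ∀ n, Set (SimpleGraph (Fin n))) {n : ℕ} (G : SimpleGraph (Fin n))
    (S : Finset (Fin n)) : Prop :=
  inducedSG G S.card S ∈ H S.card

lemma inducedSG_eq_comap {n k : ℕ} (G : SimpleGraph (Fin n)) (S : Finset (Fin n))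
    (f : Fin k → Fin n) (hf : StrictMono f) (hS : Finset.univ.image f = S) :
    inducedSG G k S = G.comap f := by
  have hc : S.card = k := by
    rw [← hS, Finset.card_image_of_injective _ hf.injective]; simp
  have h1 : f = S.orderEmbOfFin hc :=
    Finset.orderEmbOfFin_unique hc (fun x => by rw [← hS]; simp) hf
  rw [inducedSG, dif_pos hc, h1]
  rfl

lemma inducedIn_iff {H : ∀ n, Set (SimpleGraph (Fin n))} {n k : ℕ} (G : SimpleGraph (Fin n))
    (S : Finset (Fin n)) (hS : S.card = k) : InducedIn H G S ↔ inducedSG G k S ∈ H k := by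
  subst hS; rfl

lemma inducedIn_image_iff {H : ∀ n, Set (SimpleGraph (Fin n))} {n k : ℕ}
    (G : SimpleGraph (Fin n)) (f : Fin k → Fin n) (hf : StrictMono f) :
    InducedIn H G (Finset.univ.image f) ↔ G.comap f ∈ H k := by
  rw [inducedIn_iff G _ (k := k) (by rw [Finset.card_image_of_injective _ hf.injective]; simp),
    inducedSG_eq_comap G _ f hf rfl]

lemma InducedIn.mono {H : ∀ n, Set (SimpleGraph (Fin n))} (hH : Hereditary H) {n : ℕ}
    {G : SimpleGraph (Fin n)} {S T : Finset (Fin n)} (hTS : T ⊆ S) (hS : InducedIn H G S) :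
    InducedIn H G T := by
  have eS := inducedSG_eq_comap G S (S.orderEmbOfFin rfl) (S.orderEmbOfFin rfl).strictMono
    (by ext x; simp)
  set T' : Finset (Fin S.card) := Finset.univ.filter (fun i => S.orderEmbOfFin rfl i ∈ T) with hT'
  have im : T'.image (S.orderEmbOfFin rfl) = T := by
    ext x
    simp only [hT', Finset.mem_image, Finset.mem_filter, Finset.mem_univ, true_and]
    constructor
    · rintro ⟨i, hi, rfl⟩; exact hi
    · intro hx
      have : x ∈ Set.range (S.orderEmbOfFin rfl) := by
        rw [Finset.range_orderEmbOfFin]; exact hTS hx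
      obtain ⟨i, rfl⟩ := this
      exact ⟨i, hx, rfl⟩
  have cT : T'.card = T.card := by
    rw [← im, Finset.card_image_of_injective _ (S.orderEmbOfFin rfl).injective]
  have key := hH _ T.card _ hS T' cT
  rw [inducedSG_eq_comap _ T' (T'.orderEmbOfFin cT) (T'.orderEmbOfFin cT).strictMono
    (by ext x; simp), eS,
    SimpleGraph.comap_comap] at key
  unfold InducedIn
  rw [inducedSG_eq_comap G T (S.orderEmbOfFin rfl ∘ T'.orderEmbOfFin cT)
    ((S.orderEmbOfFin rfl).strictMono.comp (T'.orderEmbOfFin cT).strictMono)]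
  · exact key
  · rw [← Finset.image_image]
    conv_rhs => rw [← im]
    congr 1
    ext x; simp

/-- The number of `N`-tuples of vertices whose vertex set induces a graph outside `H`. -/
def badCount (H : ∀ n, Set (SimpleGraph (Fin n))) {n : ℕ} (G : SimpleGraph (Fin n)) (N : ℕ) : ℕ :=
  (Finset.univ.filter (fun v : Fin N → Fin n => ¬ InducedIn H G (Finset.univ.image v))).card

lemma badCount_mul_le_succ {H : ∀ n, Set (SimpleGraph (Fin n))} (hH : Hereditary H) {n : ℕ}
    (G : SimpleGraph (Fin n)) (N : ℕ) : badCount H G N * n ≤ badCount H G (N + 1) := by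
  unfold badCount
  have : (Finset.univ.filter (fun v : Fin N → Fin n =>
      ¬ InducedIn H G (Finset.univ.image v))).card * n =
      ((Finset.univ.filter (fun v : Fin N → Fin n =>
      ¬ InducedIn H G (Finset.univ.image v))) ×ˢ (Finset.univ : Finset (Fin n))).card := by
    simp [Finset.card_product]
  rw [this]
  refine Finset.card_le_card_of_injOn (fun p => (Fin.cons p.2 p.1 : Fin (N + 1) → Fin n)) ?_ ?_
  · intro p hp
    simp only [Finset.coe_product, Finset.coe_filter, Finset.mem_univ, true_and, Set.mem_prod,
      Finset.coe_univ, Set.mem_univ, and_true] at hp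
    simp only [Finset.coe_filter, Finset.mem_univ, true_and]
    intro h
    refine hp (h.mono hH ?_)
    intro x hx
    obtain ⟨i, -, rfl⟩ := Finset.mem_image.1 hx
    exact Finset.mem_image.2 ⟨i.succ, Finset.mem_univ _, by simp⟩
  · rintro ⟨a, b⟩ - ⟨a', b'⟩ - h
    have h' := Fin.cons_inj.1 h
    exact Prod.ext h'.2 h'.1

lemma badCount_ratio_mono {H : ∀ n, Set (SimpleGraph (Fin n))} (hH : Hereditary H) {n : ℕ}
    (hn : 0 < n) (G : SimpleGraph (Fin n)) :
    Monotone (fun N => (badCount H G N : ℝ) / (n : ℝ) ^ N) := by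
  refine monotone_nat_of_le_succ fun N => ?_
  have h := badCount_mul_le_succ hH G N
  have h' : (badCount H G N : ℝ) * n ≤ badCount H G (N + 1) := by exact_mod_cast h
  have hn' : (0 : ℝ) < n := by exact_mod_cast hn
  rw [div_le_div_iff₀ (by positivity) (by positivity), pow_succ]
  nlinarith [pow_pos hn' N]

lemma card_inducedIn_le {H : ∀ n, Set (SimpleGraph (Fin n))} (hH : Hereditary H) {n : ℕ}
    (G : SimpleGraph (Fin n)) (N t : ℕ) (hk : t * N ≤ n) (hn : 0 < n) (δ : ℝ)
    (hδ : δ * (n : ℝ) ^ N ≤ badCount H G N) :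
    (((Finset.powersetCard (t * N) (Finset.univ : Finset (Fin n))).filter
      (InducedIn H G)).card : ℝ) ≤ (1 - δ) ^ t * (n.choose (t * N) : ℝ) := by
  set k := t * N with hkdef
  set im : (Fin t → Fin N → Fin n) → Finset (Fin n) :=
    fun v => Finset.univ.image (Function.uncurry v) with him
  set P := Finset.powersetCard k (Finset.univ : Finset (Fin n)) with hP
  set g : ℕ → ℝ := fun j => ((n - j).choose (k - j) : ℝ)⁻¹ with hg
  have im_card : ∀ v, (im v).card ≤ k := fun v => by
    refine Finset.card_image_le.trans ?_
    simp [hkdef]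
  set κ : Finset (Fin n) → ℝ := fun S => ∑ v, if im v ⊆ S then g (im v).card else 0 with hκ
  have sup_card : ∀ T : Finset (Fin n), T.card ≤ k →
      (P.filter (fun S => T ⊆ S)).card = (n - T.card).choose (k - T.card) := by
    intro T hT
    have : (P.filter (fun S => T ⊆ S)).card = (Finset.powersetCard (k - T.card) (Tᶜ)).card := by
      refine Finset.card_bij' (fun S _ => S \ T) (fun S _ => S ∪ T) ?_ ?_ ?_ ?_
      · intro S hS
        simp only [hP, Finset.mem_filter, Finset.mem_powersetCard] at hS ⊢
        refine ⟨fun x hx => ?_, ?_⟩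
        · simp at hx ⊢; exact hx.2
        · rw [Finset.card_sdiff_of_subset hS.2, hS.1.2]
      · intro S hS
        simp only [hP, Finset.mem_filter, Finset.mem_powersetCard] at hS ⊢
        refine ⟨⟨Finset.subset_univ _, ?_⟩, Finset.subset_union_right⟩
        rw [Finset.card_union_of_disjoint, hS.2]
        · omega
        · exact Finset.disjoint_left.2 fun x hx => by simpa using hS.1 hx
      · intro S hS
        simp only [hP, Finset.mem_filter, Finset.mem_powersetCard] at hS
        exact Finset.sdiff_union_of_subset hS.2
      · intro S hS
        simp only [Finset.mem_powersetCard] at hS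
        refine Finset.union_sdiff_cancel_right ?_
        exact Finset.disjoint_left.2 fun x hx => by simpa using hS.1 hx
    rw [this, Finset.card_powersetCard, Finset.card_compl, Fintype.card_fin]
  have sum_g : ∀ v, ∑ S ∈ P, (if im v ⊆ S then g (im v).card else 0) = 1 := by
    intro v
    rw [← Finset.sum_filter, Finset.sum_const, sup_card _ (im_card v), nsmul_eq_mul]
    refine mul_inv_cancel₀ ?_
    have : 0 < (n - (im v).card).choose (k - (im v).card) := Nat.choose_pos (by omega)
    exact_mod_cast this.ne'
  have g_nonneg : ∀ j, 0 ≤ g j := fun j => by positivity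
  have κ_const : ∀ S ∈ P, ∀ S' ∈ P, κ S = κ S' := by
    intro S hS S' hS'
    simp only [hP, Finset.mem_powersetCard, Finset.subset_univ, true_and] at hS hS'
    obtain ⟨e⟩ : Nonempty (S ≃ S') := ⟨Fintype.equivOfCardEq (by simp [hS, hS'])⟩
    set σ : Equiv.Perm (Fin n) := e.extendSubtype with hσ
    have hσS : ∀ x, σ x ∈ S' ↔ x ∈ S := by
      intro x
      constructor
      · intro h
        by_contra hx
        exact e.extendSubtype_not_mem x hx h
      · exact fun h => e.extendSubtype_mem x h
    refine Fintype.sum_equiv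
      ((Equiv.arrowCongr (Equiv.refl _) (Equiv.arrowCongr (Equiv.refl _) σ))) _ _ fun v => ?_
    have h1 : im ((Equiv.arrowCongr (Equiv.refl (Fin t))
        (Equiv.arrowCongr (Equiv.refl (Fin N)) σ)) v) = (im v).image σ := by
      simp only [him, Finset.image_image]
      rfl
    rw [h1, Finset.card_image_of_injective _ σ.injective]
    have h2 : ((im v).image σ ⊆ S') = (im v ⊆ S) := propext
      ⟨fun h x hx => (hσS x).1 (h (Finset.mem_image_of_mem _ hx)), fun h x hx => by
        obtain ⟨y, hy, rfl⟩ := Finset.mem_image.1 hx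
        exact (hσS y).2 (h hy)⟩
    simp only [h2]
  have card_P : (P.card : ℝ) = n.choose k := by simp [hP]
  have sum_κ : ∑ S ∈ P, κ S = (n : ℝ) ^ k := by
    rw [hκ, Finset.sum_comm, Finset.sum_congr rfl (fun v _ => sum_g v)]
    simp [hkdef, mul_comm t N, pow_mul]
  have hC : (0 : ℝ) < n.choose k := by exact_mod_cast Nat.choose_pos hk
  have κ_val : ∀ S ∈ P, κ S = (n : ℝ) ^ k / n.choose k := by
    intro S hS
    rw [eq_div_iff hC.ne', ← sum_κ, Finset.sum_congr rfl (fun S' hS' => κ_const S' hS' S hS),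
      Finset.sum_const, nsmul_eq_mul, card_P, mul_comm]
  have good : ∑ S ∈ P.filter (InducedIn H G), κ S ≤
      ((Fintype.piFinset fun _ : Fin t => Finset.univ.filter
        (fun v : Fin N → Fin n => InducedIn H G (Finset.univ.image v))).card : ℝ) := by
    rw [hκ, Finset.sum_comm, Finset.card_eq_sum_ones, Nat.cast_sum]
    rw [← Finset.sum_filter_add_sum_filter_not Finset.univ
      (fun v => v ∈ (Fintype.piFinset fun _ : Fin t => Finset.univ.filter
        (fun v : Fin N → Fin n => InducedIn H G (Finset.univ.image v))))]
    rw [Finset.filter_univ_mem]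
    have z : ∑ x : Fin t → Fin N → Fin n with ¬ x ∈ (Fintype.piFinset fun _ : Fin t =>
        Finset.univ.filter (fun v : Fin N → Fin n => InducedIn H G (Finset.univ.image v))),
        ∑ y ∈ P.filter (InducedIn H G), (if im x ⊆ y then g (im x).card else 0) = 0 := by
      refine Finset.sum_eq_zero fun v hv => Finset.sum_eq_zero fun S hS => if_neg fun hvS => ?_
      simp only [Finset.mem_filter, Fintype.mem_piFinset, Finset.mem_univ, true_and,
        not_forall] at hv hS
      obtain ⟨j, hj⟩ := hv
      refine hj (hS.2.mono hH (subset_trans ?_ hvS))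
      intro x hx
      obtain ⟨i, -, rfl⟩ := Finset.mem_image.1 hx
      exact Finset.mem_image.2 ⟨(j, i), Finset.mem_univ _, rfl⟩
    rw [z, add_zero]
    refine Finset.sum_le_sum fun v _ => ?_
    rw [Nat.cast_one, ← sum_g v]
    refine Finset.sum_le_sum_of_subset_of_nonneg (Finset.filter_subset _ _) fun S _ _ => ?_
    split_ifs
    · exact g_nonneg _
    · exact le_rfl
  rw [Finset.sum_congr rfl (fun S hS => κ_val S (Finset.mem_filter.1 hS).1), Finset.sum_const,
    nsmul_eq_mul, Fintype.card_piFinset, Finset.prod_const, Finset.card_univ, Fintype.card_fin]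
    at good
  have hb : ((Finset.univ.filter
        (fun v : Fin N → Fin n => InducedIn H G (Finset.univ.image v))).card : ℝ)
        ≤ (1 - δ) * (n : ℝ) ^ N := by
    have h1 := Finset.card_filter_add_card_filter_not (s := (Finset.univ : Finset (Fin N → Fin n)))
      (fun v : Fin N → Fin n => InducedIn H G (Finset.univ.image v))
    have h2 : ((Finset.univ.filter
        (fun v : Fin N → Fin n => InducedIn H G (Finset.univ.image v))).card : ℝ)
        + badCount H G N = (n : ℝ) ^ N := by
      have : (Finset.univ : Finset (Fin N → Fin n)).card = n ^ N := by simp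
      rw [this] at h1
      unfold badCount
      exact_mod_cast h1
    linarith
  have hn' : (0 : ℝ) < n := by exact_mod_cast hn
  have h3 : ((P.filter (InducedIn H G)).card : ℝ) * ((n : ℝ) ^ k / n.choose k)
      ≤ (1 - δ) ^ t * (n : ℝ) ^ k := by
    refine good.trans ?_
    rw [Nat.cast_pow]
    refine (pow_le_pow_left₀ (Nat.cast_nonneg _) hb t).trans ?_
    rw [mul_pow, ← pow_mul, mul_comm N t]
  rw [← mul_div_assoc, div_le_iff₀ hC] at h3
  have h4 : (0 : ℝ) < (n : ℝ) ^ k := by positivity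
  nlinarith

/-- Graphs that are far from `H` have a positive density of small subgraphs outside `H`, provided
that sequences with vanishing densities come close to `H`. -/
lemma exists_badCount_of_far {H : ∀ n, Set (SimpleGraph (Fin n))} (hH : Hereditary H) {ε : ℝ}
    (main : ∀ (n : ℕ → ℕ), (∀ k, k + 1 ≤ n k) → ∀ G : ∀ k, SimpleGraph (Fin (n k)),
      (∀ N, Tendsto (fun k => (badCount H (G k) N : ℝ) / (n k : ℝ) ^ N) atTop (nhds 0)) →
      ∃ k, ∃ F ∈ H (n k), editDist (G k) F < ε) :
    ∃ N : ℕ, 1 ≤ N ∧ ∃ δ : ℝ, 0 < δ ∧ ∃ n₀ : ℕ, ∀ n, n₀ ≤ n → ∀ G : SimpleGraph (Fin n),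
      ε ≤ distToProp G (H n) → δ * (n : ℝ) ^ N ≤ badCount H G N := by
  by_contra! hcon
  have h1 : ∀ k : ℕ, ∃ n, k + 1 ≤ n ∧ ∃ G : SimpleGraph (Fin n), ε ≤ distToProp G (H n) ∧
      (badCount H G (k + 1) : ℝ) < ((k : ℝ) + 1)⁻¹ * (n : ℝ) ^ (k + 1) := fun k =>
    hcon (k + 1) (by omega) ((k : ℝ) + 1)⁻¹ (by positivity) (k + 1)
  choose n hn G hfar hbad using h1
  obtain ⟨k, F, hF, hlt⟩ := main n hn G fun N => by
    refine squeeze_zero' (Eventually.of_forall fun k => by positivity)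
      (g := fun k : ℕ => ((k : ℝ) + 1)⁻¹) ?_ ?_
    · filter_upwards [eventually_ge_atTop N] with k hk
      have hpos : 0 < n k := by have := hn k; omega
      have hpos' : (0 : ℝ) < n k := by exact_mod_cast hpos
      refine (badCount_ratio_mono hH hpos (G k) (by omega : N ≤ k + 1)).trans ?_
      simp only
      rw [div_le_iff₀ (by positivity)]
      exact (hbad k).le
    · simpa using tendsto_one_div_add_atTop_nhds_zero_nat (𝕜 := ℝ)
  exact absurd (hfar k) (not_le.2 ((distToProp_le hF).trans_lt hlt))

lemma removal_of_exists_badCount {H : ∀ n, Set (SimpleGraph (Fin n))} (hH : Hereditary H)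
    {ε c : ℝ} (hc : 0 < c)
    (h : ∃ N : ℕ, 1 ≤ N ∧ ∃ δ : ℝ, 0 < δ ∧ ∃ n₀ : ℕ, ∀ n, n₀ ≤ n → ∀ G : SimpleGraph (Fin n),
      ε ≤ distToProp G (H n) → δ * (n : ℝ) ^ N ≤ badCount H G N) :
    ∃ k : ℕ, 1 ≤ k ∧ ∀ n : ℕ, k ≤ n → ∀ G : SimpleGraph (Fin n),
      ε ≤ distToProp G (H n) →
      1 - c ≤
        (((Finset.powersetCard k (Finset.univ : Finset (Fin n))).filter
            (fun S : Finset (Fin n) => inducedSG G k S ∉ H k)).card : ℝ) /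
          (n.choose k : ℝ) := by
  obtain ⟨N, hN, δ, hδ, n₀, hcore⟩ := h
  set δ' := min δ 1 with hδ'
  have hδ'pos : 0 < δ' := lt_min hδ one_pos
  have hlim : Tendsto (fun t : ℕ => (1 - δ') ^ t) atTop (nhds 0) :=
    tendsto_pow_atTop_nhds_zero_of_lt_one (by linarith [min_le_right δ 1]) (by linarith)
  obtain ⟨t, ht1, ht2⟩ := ((hlim.eventually (ge_mem_nhds hc)).and
    (eventually_ge_atTop (n₀ + 1))).exists
  have htN : t ≤ t * N := Nat.le_mul_of_pos_right t hN
  refine ⟨t * N, by omega, fun n hn G hfar => ?_⟩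
  have hb := hcore n (by omega) G hfar
  have hb' : δ' * (n : ℝ) ^ N ≤ badCount H G N :=
    (mul_le_mul_of_nonneg_right (min_le_left _ _) (by positivity)).trans hb
  have hle := card_inducedIn_le hH G N t hn (by omega) δ' hb'
  have hC : (0 : ℝ) < n.choose (t * N) := by exact_mod_cast Nat.choose_pos hn
  rw [le_div_iff₀ hC]
  have hsum := Finset.card_filter_add_card_filter_not
    (s := Finset.powersetCard (t * N) (Finset.univ : Finset (Fin n))) (InducedIn H G)
  have hcongr : (Finset.powersetCard (t * N) (Finset.univ : Finset (Fin n))).filter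
      (fun S => ¬ InducedIn H G S) =
      (Finset.powersetCard (t * N) (Finset.univ : Finset (Fin n))).filter
      (fun S : Finset (Fin n) => inducedSG G (t * N) S ∉ H (t * N)) := by
    refine Finset.filter_congr fun S hS => ?_
    rw [inducedIn_iff G S (Finset.mem_powersetCard.1 hS).2]
  rw [hcongr] at hsum
  have hsum' : ((Finset.powersetCard (t * N) (Finset.univ : Finset (Fin n))).filter
      (InducedIn H G)).card + (((Finset.powersetCard (t * N) (Finset.univ : Finset (Fin n))).filter
      (fun S : Finset (Fin n) => inducedSG G (t * N) S ∉ H (t * N))).card : ℝ)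
      = n.choose (t * N) := by
    have : (Finset.powersetCard (t * N) (Finset.univ : Finset (Fin n))).card = n.choose (t * N) := by
      simp
    rw [← this, ← hsum]
    push_cast
    rfl
  have : (1 - δ') ^ t * (n.choose (t * N) : ℝ) ≤ c * n.choose (t * N) :=
    mul_le_mul_of_nonneg_right ht1 hC.le
  linarith

/-- Vertex labels in the limit object: a position in the Cantor space and a type. -/
abbrev Label : Type := (ℕ → Bool) × (ℕ → Bool × Bool)

instance : BorelSpace (ℕ → Bool) := inferInstance
instance : SecondCountableTopology Label := inferInstance
instance : BorelSpace Label := inferInstance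
instance : CompactSpace Label := inferInstance
instance : TopologicalSpace (ProbabilityMeasure Label) := inferInstance

/-- Adjacency indicator. -/
def adjInd {n : ℕ} (G : SimpleGraph (Fin n)) (u v : Fin n) : ℝ := if G.Adj u v then 1 else 0

lemma adjInd_nonneg {n : ℕ} (G : SimpleGraph (Fin n)) (u v : Fin n) : 0 ≤ adjInd G u v := by
  unfold adjInd; split_ifs <;> norm_num

lemma adjInd_le_one {n : ℕ} (G : SimpleGraph (Fin n)) (u v : Fin n) : adjInd G u v ≤ 1 := by
  unfold adjInd; split_ifs <;> norm_num

/-- The uniform probability measure on a finite nonempty type. -/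
def unifMeasure (α : Type*) [Fintype α] [Nonempty α] [MeasurableSpace α] : ProbabilityMeasure α :=
  ⟨ProbabilityTheory.uniformOn Set.univ, inferInstance⟩

lemma integral_unifMeasure {α : Type*} [Fintype α] [Nonempty α] [MeasurableSpace α]
    [MeasurableSingletonClass α] (h : α → ℝ) :
    ∫ x, h x ∂(unifMeasure α : Measure α) = (∑ x, h x) / Fintype.card α := by
  rw [integral_fintype (Integrable.of_finite), Finset.sum_div]
  refine Finset.sum_congr rfl fun x _ => ?_
  have : (unifMeasure α : Measure α).real {x} = (Fintype.card α : ℝ)⁻¹ := by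
    simp [unifMeasure, Measure.real, ProbabilityTheory.uniformOn_univ]
  rw [this, smul_eq_mul]
  ring

/-- The law of the label of a random vertex. -/
def labelLaw {n : ℕ} [NeZero n] (φ : Fin n → Label) : ProbabilityMeasure Label :=
  (unifMeasure (Fin n)).map (f := φ) (measurable_of_finite φ).aemeasurable

lemma integral_pi_labelLaw {n : ℕ} [NeZero n] (φ : Fin n → Label) (N : ℕ)
    (h : C(Fin N → Label, ℝ)) :
    ∫ p, h p ∂(Measure.pi fun _ : Fin N => (labelLaw φ : Measure Label)) =
      (∑ v : Fin N → Fin n, h (fun i => φ (v i))) / (n : ℝ) ^ N := by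
  have h1 : (Measure.pi fun _ : Fin N => (labelLaw φ : Measure Label)) =
      (Measure.pi fun _ : Fin N => (unifMeasure (Fin n) : Measure (Fin n))).map
        (fun v i => φ (v i)) := by
    rw [Measure.pi_map_pi (fun i => (measurable_of_finite φ).aemeasurable)]
    rfl
  rw [h1, integral_map (measurable_of_finite _).aemeasurable
    h.continuous.aestronglyMeasurable, integral_fintype (Integrable.of_finite), Finset.sum_div]
  refine Finset.sum_congr rfl fun v _ => ?_
  have : (Measure.pi fun _ : Fin N => (unifMeasure (Fin n) : Measure (Fin n))).real {v}
      = ((n : ℝ) ^ N)⁻¹ := by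
    simp [unifMeasure, Measure.real, ProbabilityTheory.uniformOn_univ]
  rw [this, smul_eq_mul]
  ring

lemma integral_prod_labelLaw {n : ℕ} [NeZero n] (φ : Fin n → Label) (h : Label × Label → ℝ)
    (hm : Measurable h) :
    ∫ p, h p ∂((labelLaw φ : Measure Label).prod (labelLaw φ : Measure Label)) =
      (∑ u, ∑ v, h (φ u, φ v)) / (n : ℝ) ^ 2 := by
  have h1 : (labelLaw φ : Measure Label).prod (labelLaw φ : Measure Label) =
      ((unifMeasure (Fin n) : Measure (Fin n)).prod (unifMeasure (Fin n) : Measure (Fin n))).map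
        (Prod.map φ φ) := by
    rw [← Measure.map_prod_map _ _ (measurable_of_finite φ) (measurable_of_finite φ)]
    rfl
  rw [h1, integral_map (measurable_of_finite _).aemeasurable
    hm.aestronglyMeasurable, integral_fintype (Integrable.of_finite), ← Fintype.sum_prod_type'
    (f := fun u v => h (φ u, φ v)), Finset.sum_div]
  refine Finset.sum_congr rfl fun v _ => ?_
  have : ((unifMeasure (Fin n) : Measure (Fin n)).prod (unifMeasure (Fin n) :
      Measure (Fin n))).real {v} = ((n : ℝ) ^ 2)⁻¹ := by
    rw [← Prod.mk.eta (p := v), ← Set.singleton_prod_singleton, measureReal_def,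
      Measure.prod_prod]
    simp [unifMeasure, ProbabilityTheory.uniformOn_univ]
    ring
  rw [this, smul_eq_mul]
  simp only [Prod.map]
  ring

/-- A limit along the hyperfilter of a sequence in a compact space. -/
lemma exists_tendsto_hyperfilter {E : Type*} [TopologicalSpace E] [CompactSpace E] (s : ℕ → E) :
    ∃ x, Tendsto s (hyperfilter ℕ : Filter ℕ) (nhds x) := by
  obtain ⟨x, -, hx⟩ := isCompact_univ.ultrafilter_le_nhds ((hyperfilter ℕ).map s) (by simp)
  exact ⟨x, hx⟩

section Limit

variable {n : ℕ → ℕ} [∀ k, NeZero (n k)]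

lemma tendsto_pi_average {φ : ∀ k, Fin (n k) → Label} {μ : ProbabilityMeasure Label}
    (hμ : Tendsto (fun k => labelLaw (φ k)) (hyperfilter ℕ : Filter ℕ) (nhds μ)) (N : ℕ)
    (h : C(Fin N → Label, ℝ)) :
    Tendsto (fun k => (∑ v : Fin N → Fin (n k), h (fun i => φ k (v i))) / (n k : ℝ) ^ N)
      (hyperfilter ℕ : Filter ℕ) (nhds (∫ p, h p ∂(Measure.pi fun _ => (μ : Measure Label)))) := by
  have h1 : Tendsto (fun k => ProbabilityMeasure.pi fun _ : Fin N => labelLaw (φ k))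
      (hyperfilter ℕ : Filter ℕ) (nhds (ProbabilityMeasure.pi fun _ : Fin N => μ)) :=
    (ProbabilityMeasure.continuous_pi.tendsto _).comp (tendsto_pi_nhds.2 fun _ => hμ)
  have h2 := ProbabilityMeasure.tendsto_iff_forall_integral_tendsto.1 h1
    (BoundedContinuousFunction.mkOfCompact h)
  refine h2.congr fun k => ?_
  exact integral_pi_labelLaw (φ k) N h

lemma tendsto_pair_average {φ : ∀ k, Fin (n k) → Label} {μ : ProbabilityMeasure Label}
    (hμ : Tendsto (fun k => labelLaw (φ k)) (hyperfilter ℕ : Filter ℕ) (nhds μ))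
    (h : C(Label × Label, ℝ)) :
    Tendsto (fun k => (∑ u, ∑ v, h (φ k u, φ k v)) / (n k : ℝ) ^ 2)
      (hyperfilter ℕ : Filter ℕ) (nhds (∫ p, h p ∂((μ : Measure Label).prod μ))) := by
  have h1 : Tendsto (fun k => (labelLaw (φ k)).prod (labelLaw (φ k)))
      (hyperfilter ℕ : Filter ℕ) (nhds (μ.prod μ)) :=
    (ProbabilityMeasure.continuous_prod.tendsto (μ, μ)).comp (hμ.prodMk_nhds hμ)
  have h2 := ProbabilityMeasure.tendsto_iff_forall_integral_tendsto.1 h1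
    (BoundedContinuousFunction.mkOfCompact h)
  refine h2.congr fun k => ?_
  exact integral_prod_labelLaw (φ k) h h.continuous.measurable

/-- The edge densities of a sequence of labelled graphs have a limiting density. -/
lemma exists_edge_limit (G : ∀ k, SimpleGraph (Fin (n k))) {φ : ∀ k, Fin (n k) → Label}
    {μ : ProbabilityMeasure Label}
    (hμ : Tendsto (fun k => labelLaw (φ k)) (hyperfilter ℕ : Filter ℕ) (nhds μ)) :
    ∃ W : Label × Label → ℝ, Measurable W ∧ (∀ p, W p ∈ Set.Icc (0 : ℝ) 1) ∧
      ∀ h : C(Label × Label, ℝ),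
        Tendsto (fun k => (∑ u, ∑ v, adjInd (G k) u v * h (φ k u, φ k v)) / (n k : ℝ) ^ 2)
          (hyperfilter ℕ : Filter ℕ) (nhds (∫ p, W p * h p ∂((μ : Measure Label).prod μ))) := by
  set law : ℕ → ProbabilityMeasure ((Label × Label) × Bool) := fun k =>
    (unifMeasure (Fin (n k) × Fin (n k))).map
      (f := fun q => ((φ k q.1, φ k q.2), decide ((G k).Adj q.1 q.2)))
      (measurable_of_finite _).aemeasurable with hlaw
  have hlaw_int : ∀ k (f : (Label × Label) × Bool → ℝ), Measurable f →
      ∫ x, f x ∂(law k : Measure ((Label × Label) × Bool)) =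
      (∑ u, ∑ v, f ((φ k u, φ k v), decide ((G k).Adj u v))) / (n k : ℝ) ^ 2 := by
    intro k f hf
    rw [hlaw]
    simp only [ProbabilityMeasure.toMeasure_map]
    rw [integral_map (measurable_of_finite _).aemeasurable hf.aestronglyMeasurable,
      integral_unifMeasure, Fintype.sum_prod_type]
    simp [sq]
  obtain ⟨ω, hω⟩ := exists_tendsto_hyperfilter law
  have h_int : ∀ f : C((Label × Label) × Bool, ℝ), Tendsto (fun k =>
      (∑ u, ∑ v, f ((φ k u, φ k v), decide ((G k).Adj u v))) / (n k : ℝ) ^ 2)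
      (hyperfilter ℕ : Filter ℕ) (nhds (∫ x, f x ∂(ω : Measure ((Label × Label) × Bool)))) := by
    intro f
    refine (ProbabilityMeasure.tendsto_iff_forall_integral_tendsto.1 hω
      (BoundedContinuousFunction.mkOfCompact f)).congr fun k => ?_
    exact hlaw_int k f f.continuous.measurable
  have hfst : (ω : Measure ((Label × Label) × Bool)).fst = (μ : Measure Label).prod μ := by
    refine ext_of_forall_integral_eq_of_IsFiniteMeasure fun f => ?_
    have e1 := h_int (f.toContinuousMap.comp ⟨Prod.fst, continuous_fst⟩)
    have e2 := tendsto_pair_average hμ f.toContinuousMap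
    have e3 := tendsto_nhds_unique e1 e2
    rw [Measure.fst, integral_map measurable_fst.aemeasurable
      f.continuous.aestronglyMeasurable]
    exact e3
  set κ := (ω : Measure ((Label × Label) × Bool)).condKernel with hκ
  refine ⟨fun p => (κ p).real {true}, ?_, fun p => ⟨measureReal_nonneg, measureReal_le_one⟩, ?_⟩
  · exact (ProbabilityTheory.Kernel.measurable_coe κ (MeasurableSet.singleton _)).ennreal_toReal
  · intro h
    set f : C((Label × Label) × Bool, ℝ) :=
      ⟨fun x => (if x.2 = true then 1 else 0) * h x.1, by
        refine Continuous.mul ?_ (h.continuous.comp continuous_fst)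
        exact (continuous_of_discreteTopology
          (f := fun b : Bool => if b = true then (1 : ℝ) else 0)).comp continuous_snd⟩ with hf
    have e1 := h_int f
    have e2 : ∫ x, f x ∂(ω : Measure ((Label × Label) × Bool)) =
        ∫ p, (κ p).real {true} * h p ∂((μ : Measure Label).prod μ) := by
      rw [← hfst, ← (ω : Measure ((Label × Label) × Bool)).disintegrate
        (ω : Measure ((Label × Label) × Bool)).condKernel, Measure.integral_compProd,
        Measure.fst_compProd]
      · refine integral_congr_ae (ae_of_all _ fun p => ?_)
        simp only [hf, ContinuousMap.coe_mk]
        rw [integral_mul_const]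
        congr 1
        rw [integral_fintype (Integrable.of_finite)]
        simp [hκ]
      · rw [Measure.disintegrate]
        exact (BoundedContinuousFunction.mkOfCompact f).integrable _
    rw [← e2]
    refine e1.congr fun k => ?_
    simp [hf, adjInd]

end Limit

/-- Replace all entries of a sequence from index `m` on by the default value. -/
def truncSeq {α : Type*} [Inhabited α] (m : ℕ) (x : ℕ → α) : ℕ → α :=
  fun i => if i < m then x i else default

lemma continuous_truncSeq {α : Type*} [Inhabited α] [TopologicalSpace α] (m : ℕ) :
    Continuous (truncSeq (α := α) m) := by
  refine continuous_pi fun i => ?_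
  unfold truncSeq
  split_ifs
  · exact continuous_apply i
  · exact continuous_const

lemma tendsto_truncSeq {α : Type*} [Inhabited α] [TopologicalSpace α] (x : ℕ → α) :
    Tendsto (fun m => truncSeq m x) atTop (nhds x) := by
  refine tendsto_pi_nhds.2 fun i => tendsto_const_nhds.congr' ?_
  filter_upwards [eventually_gt_atTop i] with m hm
  simp [truncSeq, hm]

section Cut

variable {n : ℕ}

/-- The sum of the entries of a matrix over a rectangle. -/
def cutSum (c : Fin n → Fin n → ℝ) (A B : Fin n → Bool) : ℝ :=
  ∑ u, ∑ v, (if A u then 1 else 0) * (if B v then 1 else 0) * c u v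

lemma exists_max_cutSum (c : Fin n → Fin n → ℝ) :
    ∃ P : (Fin n → Bool) × (Fin n → Bool), ∀ A B, |cutSum c A B| ≤ |cutSum c P.1 P.2| := by
  obtain ⟨P, hP⟩ := Finite.exists_max
    (fun P : (Fin n → Bool) × (Fin n → Bool) => |cutSum c P.1 P.2|)
  exact ⟨P, fun A B => hP (A, B)⟩

/-- A rectangle with extremal entry sum. -/
def optCut (c : Fin n → Fin n → ℝ) : (Fin n → Bool) × (Fin n → Bool) :=
  (exists_max_cutSum c).choose

lemma abs_cutSum_le (c : Fin n → Fin n → ℝ) (A B : Fin n → Bool) :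
    |cutSum c A B| ≤ |cutSum c (optCut c).1 (optCut c).2| :=
  (exists_max_cutSum c).choose_spec A B

lemma sum_weight_le (a d : Fin n → ℝ) (ha : ∀ u, a u ∈ Set.Icc (0 : ℝ) 1) :
    ∑ u, a u * d u ≤ ∑ u, (if decide (0 < d u) then 1 else 0) * d u := by
  refine Finset.sum_le_sum fun u _ => ?_
  obtain ⟨h0, h1⟩ := ha u
  by_cases h : 0 < d u
  · simp only [h, decide_true, if_true]
    exact mul_le_mul_of_nonneg_right h1 h.le
  · simp only [h, decide_false]
    push Not at h
    simpa using mul_nonpos_of_nonneg_of_nonpos h0 h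

lemma weighted_sum_le {c : Fin n → Fin n → ℝ} {M : ℝ} (hM : ∀ A B, cutSum c A B ≤ M)
    {a b : Fin n → ℝ} (ha : ∀ u, a u ∈ Set.Icc (0 : ℝ) 1) (hb : ∀ u, b u ∈ Set.Icc (0 : ℝ) 1) :
    ∑ u, ∑ v, a u * b v * c u v ≤ M := by
  set A : Fin n → Bool := fun u => decide (0 < ∑ v, b v * c u v) with hA
  have h1 : ∑ u, ∑ v, a u * b v * c u v ≤
      ∑ v, b v * ∑ u, (if A u then 1 else 0) * c u v := by
    calc ∑ u, ∑ v, a u * b v * c u v = ∑ u, a u * ∑ v, b v * c u v := by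
          simp only [Finset.mul_sum, mul_assoc]
      _ ≤ ∑ u, (if A u then 1 else 0) * ∑ v, b v * c u v := sum_weight_le a _ ha
      _ = _ := by
          simp only [Finset.mul_sum]
          rw [Finset.sum_comm]
          exact Finset.sum_congr rfl fun v _ => Finset.sum_congr rfl fun u _ => by ring
  refine h1.trans ((sum_weight_le b _ hb).trans ?_)
  refine le_trans (le_of_eq ?_)
    (hM A fun v => decide (0 < ∑ u, (if A u then 1 else 0) * c u v))
  unfold cutSum
  simp only [Finset.mul_sum]
  rw [Finset.sum_comm]
  exact Finset.sum_congr rfl fun v _ => Finset.sum_congr rfl fun u _ => by ring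

lemma abs_weighted_sum_le {c : Fin n → Fin n → ℝ} {M : ℝ} (hM : ∀ A B, |cutSum c A B| ≤ M)
    {a b : Fin n → ℝ} (ha : ∀ u, a u ∈ Set.Icc (0 : ℝ) 1) (hb : ∀ u, b u ∈ Set.Icc (0 : ℝ) 1) :
    |∑ u, ∑ v, a u * b v * c u v| ≤ M := by
  refine abs_le.2 ⟨?_, weighted_sum_le (fun A B => (abs_le.1 (hM A B)).2) ha hb⟩
  have := weighted_sum_le (c := fun u v => -c u v) (M := M) (fun A B => by
    have h : cutSum (fun u v => -c u v) A B = -cutSum c A B := by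
      simp [cutSum]
    rw [h]
    linarith [(abs_le.1 (hM A B)).1]) ha hb
  have h2 : ∑ u, ∑ v, a u * b v * -c u v = -∑ u, ∑ v, a u * b v * c u v := by simp
  linarith

variable (G : SimpleGraph (Fin n)) (x : Fin n → ℕ → Bool) (U : ℕ → Label × Label → ℝ)

/-- Discrepancy between a graph and a function of the labels. -/
def discrepancy (V : Label × Label → ℝ) (z : Fin n → ℕ → Bool × Bool) (u v : Fin n) : ℝ :=
  adjInd G u v - V ((x u, z u), (x v, z v))

/-- The first stages of the recursive construction of the types of the vertices. -/
def typeStage : ℕ → Fin n → ℕ → Bool × Bool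
  | 0 => fun _ _ => default
  | s + 1 => fun v => Function.update (typeStage s v) s
      ((optCut (discrepancy G x (U s.unpair.1) (typeStage s))).1 v,
        (optCut (discrepancy G x (U s.unpair.1) (typeStage s))).2 v)

/-- Types of vertices: entry `s` records a rectangle witnessing the discrepancy to `U s.unpair.1`
evaluated on the types truncated at `s`. -/
def vertexType (v : Fin n) (i : ℕ) : Bool × Bool := typeStage G x U (i + 1) v i

lemma typeStage_eq (s : ℕ) (v : Fin n) :
    typeStage G x U s v = truncSeq s (vertexType G x U v) := by
  induction s with
  | zero => funext i; simp [typeStage, truncSeq]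
  | succ s ih =>
    funext i
    rcases lt_trichotomy i s with h | rfl | h
    · have h' : i < s + 1 := by omega
      have := congrFun ih i
      simp only [truncSeq, h, if_true] at this
      simp [typeStage, truncSeq, Function.update_of_ne h.ne, h', this]
    · simp [truncSeq, vertexType]
    · have h' : ¬ i < s + 1 := by omega
      have h'' : ¬ i < s := by omega
      have := congrFun ih i
      simp only [truncSeq, h'', if_false] at this
      simp [typeStage, truncSeq, Function.update_of_ne h.ne', h', this]

lemma abs_cutSum_discrepancy_le (s : ℕ) (A B : Fin n → Bool) :
    |cutSum (discrepancy G x (U s.unpair.1) fun v => truncSeq s (vertexType G x U v)) A B| ≤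
    |cutSum (discrepancy G x (U s.unpair.1) fun v => truncSeq s (vertexType G x U v))
      (fun v => (vertexType G x U v s).1) (fun v => (vertexType G x U v s).2)| := by
  have h : typeStage G x U s = fun v => truncSeq s (vertexType G x U v) :=
    funext fun v => typeStage_eq G x U s v
  have h2 : ∀ v, vertexType G x U v s =
      ((optCut (discrepancy G x (U s.unpair.1) (typeStage G x U s))).1 v,
        (optCut (discrepancy G x (U s.unpair.1) (typeStage G x U s))).2 v) := fun v => by
    simp [vertexType, typeStage]
  simp only [h2]
  rw [← h]
  exact abs_cutSum_le _ A B

end Cut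

lemma abs_cutSum_sub_le {n : ℕ} {c d : Fin n → Fin n → ℝ} {M : ℝ}
    (h : ∑ u, ∑ v, |c u v - d u v| ≤ M) (A B : Fin n → Bool) :
    |cutSum c A B| ≤ |cutSum d A B| + M := by
  have h1 : |cutSum c A B - cutSum d A B| ≤ M := by
    refine le_trans ?_ h
    unfold cutSum
    rw [← Finset.sum_sub_distrib]
    refine (Finset.abs_sum_le_sum_abs _ _).trans (Finset.sum_le_sum fun u _ => ?_)
    rw [← Finset.sum_sub_distrib]
    refine (Finset.abs_sum_le_sum_abs _ _).trans (Finset.sum_le_sum fun v _ => ?_)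
    rw [← mul_sub, abs_mul]
    refine mul_le_of_le_one_left (abs_nonneg _) ?_
    split_ifs <;> norm_num
  have := abs_sub_abs_le_abs_sub (cutSum c A B) (cutSum d A B)
  linarith

lemma exists_continuous_approx {E : Type*} [TopologicalSpace E] [NormalSpace E]
    [MeasurableSpace E] [BorelSpace E] (ν : Measure E) [IsProbabilityMeasure ν]
    [ν.WeaklyRegular] {W : E → ℝ} (hW : Measurable W) (hW1 : ∀ p, W p ∈ Set.Icc (0 : ℝ) 1)
    {δ : ℝ} (hδ : 0 < δ) :
    ∃ U : C(E, Set.Icc (0 : ℝ) 1), ∫ p, |W p - U p| ∂ν ≤ δ := by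
  have hWi : Integrable W ν := by
    refine Integrable.of_bound hW.aestronglyMeasurable 1 (ae_of_all _ fun p => ?_)
    rw [Real.norm_eq_abs, abs_of_nonneg (hW1 p).1]
    exact (hW1 p).2
  obtain ⟨g, hg, hgi⟩ := hWi.exists_boundedContinuous_integral_sub_le hδ
  refine ⟨⟨fun p => Set.projIcc 0 1 zero_le_one (g p),
    continuous_projIcc.comp g.continuous⟩, le_trans (integral_mono_of_nonneg
      (ae_of_all _ fun _ => abs_nonneg _) (hWi.sub hgi).norm (ae_of_all _ fun p => ?_)) hg⟩
  have h : W p = (Set.projIcc (0 : ℝ) 1 zero_le_one (W p) : ℝ) := by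
    rw [Set.projIcc_of_mem zero_le_one (hW1 p)]
  simp only [ContinuousMap.coe_mk, Pi.sub_apply, Real.norm_eq_abs]
  conv_lhs => rw [h]
  exact Set.abs_projIcc_sub_projIcc zero_le_one

/-- A limit of a sequence of ordered graphs, where vertices carry labels extending prescribed
positions. -/
structure LimitObject {n : ℕ → ℕ} [∀ k, NeZero (n k)] (G : ∀ k, SimpleGraph (Fin (n k)))
    (x : ∀ k, Fin (n k) → ℕ → Bool) where
  φ : ∀ k, Fin (n k) → Label
  fst_φ : ∀ k v, (φ k v).1 = x k v
  μ : ProbabilityMeasure Label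
  lim : Tendsto (fun k => labelLaw (φ k)) (hyperfilter ℕ : Filter ℕ) (nhds μ)
  W : Label × Label → ℝ
  measurable_W : Measurable W
  W_mem : ∀ p, W p ∈ Set.Icc (0 : ℝ) 1
  edge : ∀ h : C(Label × Label, ℝ),
    Tendsto (fun k => (∑ u, ∑ v, adjInd (G k) u v * h (φ k u, φ k v)) / (n k : ℝ) ^ 2)
      (hyperfilter ℕ : Filter ℕ) (nhds (∫ p, W p * h p ∂((μ : Measure Label).prod μ)))
  cut : ∀ δ : ℝ, 0 < δ → ∃ U : C(Label × Label, Set.Icc (0 : ℝ) 1),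
    ∫ p, |W p - U p| ∂((μ : Measure Label).prod μ) ≤ δ ∧
    ∀ᶠ k in (hyperfilter ℕ : Filter ℕ), ∀ a b : Fin (n k) → ℝ,
      (∀ u, a u ∈ Set.Icc (0 : ℝ) 1) → (∀ u, b u ∈ Set.Icc (0 : ℝ) 1) →
      |∑ u, ∑ v, a u * b v * (adjInd (G k) u v - U (φ k u, φ k v))| ≤ δ * (n k : ℝ) ^ 2

lemma nonempty_limitObject {n : ℕ → ℕ} [∀ k, NeZero (n k)] (G : ∀ k, SimpleGraph (Fin (n k)))
    (x : ∀ k, Fin (n k) → ℕ → Bool) : Nonempty (LimitObject G x) := by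
  set D : ℕ → C(Label × Label, Set.Icc (0 : ℝ) 1) := TopologicalSpace.denseSeq _ with hD
  set z : ∀ k, Fin (n k) → ℕ → Bool × Bool := fun k =>
    vertexType (G k) (x k) (fun j p => (D j p : ℝ)) with hz
  set φ : ∀ k, Fin (n k) → Label := fun k v => (x k v, z k v) with hφ
  obtain ⟨μ, hμ⟩ := exists_tendsto_hyperfilter (fun k => labelLaw (φ k))
  obtain ⟨W, hWm, hW1, hW⟩ := exists_edge_limit G hμ
  refine ⟨⟨φ, fun _ _ => rfl, μ, hμ, W, hWm, hW1, hW, fun δ hδ => ?_⟩⟩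
  set ν := (μ : Measure Label).prod (μ : Measure Label) with hν
  have bint : ∀ {f : Label × Label → ℝ}, Measurable f → (∀ p, |f p| ≤ 1) → Integrable f ν :=
    fun hf h1 => Integrable.of_bound hf.aestronglyMeasurable 1 (ae_of_all _ h1)
  have abs_sub_le : ∀ {a b : ℝ}, a ∈ Set.Icc (0 : ℝ) 1 → b ∈ Set.Icc (0 : ℝ) 1 → |a - b| ≤ 1 :=
    fun ha hb => abs_le.2 ⟨by linarith [ha.1, hb.2], by linarith [ha.2, hb.1]⟩
  obtain ⟨U₀, hU₀⟩ := exists_continuous_approx ν hWm hW1 (by positivity : 0 < δ / 8)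
  obtain ⟨j, hj⟩ := (TopologicalSpace.denseRange_denseSeq C(Label × Label, Set.Icc (0 : ℝ) 1)
    |>.exists_dist_lt U₀ (by positivity : 0 < δ / 8))
  have hjp : ∀ p, |(U₀ p : ℝ) - D j p| ≤ δ / 8 := fun p =>
    ((ContinuousMap.dist_apply_le_dist p).trans hj.le)
  set u : Label × Label → ℝ := fun p => (D j p : ℝ) with hu
  have hucont : Continuous u := continuous_subtype_val.comp (D j).continuous
  have humem : ∀ p, u p ∈ Set.Icc (0 : ℝ) 1 := fun p => (D j p).2
  have hWu : ∫ p, |W p - u p| ∂ν ≤ δ / 4 := by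
    have h1 : ∫ p, |W p - u p| ∂ν ≤ ∫ p, (|W p - U₀ p| + δ / 8) ∂ν := by
      refine integral_mono_of_nonneg (ae_of_all _ fun _ => abs_nonneg _) ?_
        (ae_of_all _ fun p => ?_)
      · refine Integrable.add (bint ?_ fun p => ?_) (integrable_const _)
        · exact (hWm.sub (continuous_subtype_val.comp U₀.continuous).measurable).abs
        · rw [abs_abs]; exact abs_sub_le (hW1 p) (U₀ p).2
      · exact (_root_.abs_sub_le (W p) (U₀ p) (u p)).trans (add_le_add le_rfl (hjp p))
    refine h1.trans ?_
    rw [integral_add (bint (f := fun p => |W p - U₀ p|) (hWm.sub (continuous_subtype_val.comp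
      U₀.continuous).measurable).abs fun p => by
        rw [abs_abs]; exact abs_sub_le (hW1 p) (U₀ p).2) (integrable_const _)]
    simp only [integral_const, probReal_univ, smul_eq_mul, one_mul]
    linarith
  set τ : ℕ → Label × Label → Label × Label := fun s p =>
    ((p.1.1, truncSeq s p.1.2), (p.2.1, truncSeq s p.2.2)) with hτ
  have hτc : ∀ s, Continuous (τ s) := fun s => by
    have := continuous_truncSeq (α := Bool × Bool) s
    fun_prop
  have hτlim : ∀ p, Tendsto (fun s => τ s p) atTop (nhds p) := fun p =>
    (tendsto_const_nhds.prodMk_nhds (tendsto_truncSeq _)).prodMk_nhds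
      (tendsto_const_nhds.prodMk_nhds (tendsto_truncSeq _))
  have htrunc : Tendsto (fun s => ∫ p, |u p - u (τ s p)| ∂ν) atTop (nhds 0) := by
    have := tendsto_integral_of_dominated_convergence (μ := ν)
      (F := fun s p => |u p - u (τ s p)|) (f := fun p => 0) (fun _ => 1)
      (fun s => ((hucont.sub (hucont.comp (hτc s))).abs).aestronglyMeasurable)
      (integrable_const _) (fun s => ae_of_all _ fun p => by
        rw [Real.norm_eq_abs, abs_abs]; exact abs_sub_le (humem _) (humem _))
      (ae_of_all _ fun p => by
        have h1 := (hucont.tendsto p).comp (hτlim p)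
        have h2 := (tendsto_const_nhds (x := u p)).sub h1
        simpa using h2.abs)
    simpa using this
  obtain ⟨t, ht⟩ := ((htrunc.eventually (gt_mem_nhds (by positivity : 0 < δ / 8))).and
    (eventually_ge_atTop 0)).exists_forall_of_atTop
  set s := Nat.pair j t with hs
  have hs1 : s.unpair.1 = j := by simp [hs]
  have hsmall := (ht s (Nat.right_le_pair j t)).1
  refine ⟨D j, hWu.trans (by linarith), ?_⟩
  set h : C(Label × Label, ℝ) := ⟨fun p => (if (p.1.2 s).1 then 1 else 0) *
      (if (p.2.2 s).2 then 1 else 0), by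
    have c1 : Continuous fun b : Bool => if b then (1 : ℝ) else 0 := continuous_of_discreteTopology
    exact (c1.comp (f := fun p : Label × Label => (p.1.2 s).1) (by fun_prop)).mul
      (c1.comp (f := fun p : Label × Label => (p.2.2 s).2) (by fun_prop))⟩ with hh
  have hh1 : ∀ p, |h p| ≤ 1 := fun p => by
    simp only [hh, ContinuousMap.coe_mk]; split_ifs <;> norm_num
  have e1 := (hW h).sub (tendsto_pair_average hμ (⟨u, hucont⟩ * h))
  have e1' : |∫ p, W p * h p ∂ν - ∫ p, (⟨u, hucont⟩ * h : C(Label × Label, ℝ)) p ∂ν| < 3 * δ / 8 := by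
    have hle : ∀ {a b : ℝ}, |a| ≤ 1 → |b| ≤ 1 → |a * b| ≤ 1 := fun ha hb => by
      rw [abs_mul]; exact mul_le_one₀ ha (abs_nonneg _) hb
    have habs : ∀ {a : ℝ}, a ∈ Set.Icc (0 : ℝ) 1 → |a| ≤ 1 := fun ha => by
      rw [abs_of_nonneg ha.1]; exact ha.2
    rw [← integral_sub (bint (f := fun p => W p * h p) (hWm.mul h.continuous.measurable) fun p => hle (habs (hW1 p)) (hh1 p))
      (bint (⟨u, hucont⟩ * h : C(Label × Label, ℝ)).continuous.measurable
        fun p => hle (habs (humem p)) (hh1 p))]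
    refine (abs_integral_le_integral_abs.trans (integral_mono_of_nonneg
      (ae_of_all _ fun _ => abs_nonneg _) (bint (hWm.sub hucont.measurable).abs fun p => ?_)
      (ae_of_all _ fun p => ?_))).trans_lt (hWu.trans_lt (by linarith))
    · simp only [Pi.sub_apply, abs_abs]; exact abs_sub_le (hW1 p) (humem p)
    · simp only [ContinuousMap.mul_apply, ContinuousMap.coe_mk, Pi.sub_apply]
      rw [← sub_mul, abs_mul]
      exact mul_le_of_le_one_right (abs_nonneg _) (hh1 p)
  have e2 := tendsto_pair_average hμ ⟨fun p => |u p - u (τ s p)|,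
    (hucont.sub (hucont.comp (hτc s))).abs⟩
  filter_upwards [e1.abs.eventually (gt_mem_nhds e1'), e2.eventually (gt_mem_nhds hsmall)]
    with k hk1 hk2 a b ha hb
  have hnpos : (0 : ℝ) < (n k : ℝ) ^ 2 := by
    have := NeZero.pos (n k)
    positivity
  rw [← sub_div, abs_div, abs_of_pos hnpos, div_lt_iff₀ hnpos] at hk1
  rw [div_lt_iff₀ hnpos] at hk2
  set c : Fin (n k) → Fin (n k) → ℝ := fun v w => adjInd (G k) v w - u (φ k v, φ k w) with hc
  set d := discrepancy (G k) (x k) u (fun v => truncSeq s (z k v)) with hd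
  have hcd : ∀ v w, |c v w - d v w| = |u (φ k v, φ k w) - u (τ s (φ k v, φ k w))| := fun v w => by
    simp only [hc, hd, discrepancy, hτ, hφ]
    rw [abs_sub_comm]
    congr 1
    ring
  have hsum : ∑ v, ∑ w, |c v w - d v w| ≤ δ / 8 * (n k : ℝ) ^ 2 := by
    simp only [hcd]
    exact hk2.le
  have hsum' : ∑ v, ∑ w, |d v w - c v w| ≤ δ / 8 * (n k : ℝ) ^ 2 := by
    simp only [abs_sub_comm (d _ _)]
    exact hsum
  have hopt : |cutSum c (fun v => (z k v s).1) (fun v => (z k v s).2)| ≤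
      3 * δ / 8 * (n k : ℝ) ^ 2 := by
    refine le_trans (le_of_eq ?_) hk1.le
    congr 1
    unfold cutSum
    simp only [← Finset.sum_sub_distrib]
    refine Finset.sum_congr rfl fun v _ => Finset.sum_congr rfl fun w _ => ?_
    simp only [hh, hc, hφ, ContinuousMap.mul_apply, ContinuousMap.coe_mk]
    ring
  have hmax : ∀ A B, |cutSum d A B| ≤
      |cutSum d (fun v => (z k v s).1) (fun v => (z k v s).2)| := fun A B => by
    have := abs_cutSum_discrepancy_le (G k) (x k) (fun j p => (D j p : ℝ)) s A B
    rw [hs1] at this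
    exact this
  refine (abs_weighted_sum_le (c := c) (M := δ * (n k : ℝ) ^ 2) (fun A B => ?_) ha hb)
  have i1 := abs_cutSum_sub_le hsum A B
  have i2 := abs_cutSum_sub_le hsum' (fun v => (z k v s).1) (fun v => (z k v s).2)
  have i3 := hmax A B
  nlinarith

section Swap

variable {V I : Type*} [DecidableEq I]

/-- As a function of the coordinates `i` and `j` alone, `R` is a product of weights. -/
def Separable₂ (i j : I) (R : (I → V) → ℝ) : Prop :=
  ∀ v, ∃ a b : V → ℝ, (∀ x, a x ∈ Set.Icc (0 : ℝ) 1) ∧ (∀ x, b x ∈ Set.Icc (0 : ℝ) 1) ∧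
    ∀ x y, R (Function.update (Function.update v i x) j y) = a x * b y

lemma Separable₂.mul {i j : I} {R S : (I → V) → ℝ} (hR : Separable₂ i j R)
    (hS : Separable₂ i j S) : Separable₂ i j (fun v => R v * S v) := by
  intro v
  obtain ⟨a, b, ha, hb, hab⟩ := hR v
  obtain ⟨a', b', ha', hb', hab'⟩ := hS v
  refine ⟨fun x => a x * a' x, fun y => b y * b' y,
    fun x => ⟨mul_nonneg (ha x).1 (ha' x).1, mul_le_one₀ (ha x).2 (ha' x).1 (ha' x).2⟩,
    fun x => ⟨mul_nonneg (hb x).1 (hb' x).1, mul_le_one₀ (hb x).2 (hb' x).1 (hb' x).2⟩,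
    fun x y => ?_⟩
  simp only [hab, hab']
  ring

lemma Separable₂.one (i j : I) : Separable₂ i j (fun _ : I → V => (1 : ℝ)) := fun _ =>
  ⟨fun _ => 1, fun _ => 1, by simp, by simp, by simp⟩

lemma Separable₂.prod {ι : Type*} {i j : I} (s : Finset ι) {R : ι → (I → V) → ℝ}
    (hR : ∀ e ∈ s, Separable₂ i j (R e)) : Separable₂ i j (fun v => ∏ e ∈ s, R e v) := by
  induction s using Finset.induction with
  | empty => simpa using Separable₂.one i j
  | insert e s he ih =>
    simp only [Finset.prod_insert he]
    exact (hR e (Finset.mem_insert_self _ _)).mul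
      (ih fun e' he' => hR e' (Finset.mem_insert_of_mem he'))

lemma separable₂_vertex {i j : I} (hij : i ≠ j) (l : I) {w : V → ℝ}
    (hw : ∀ x, w x ∈ Set.Icc (0 : ℝ) 1) : Separable₂ i j (fun v : I → V => w (v l)) := by
  intro v
  by_cases hj : l = j
  · subst hj
    exact ⟨fun _ => 1, w, by simp, hw, by simp⟩
  · refine ⟨fun x => w (Function.update v i x l), fun _ => 1, fun x => hw _, by simp,
      fun x y => ?_⟩
    simp [Function.update_of_ne hj]

lemma separable₂_edge [PartialOrder I] {e e' : I × I} (he : e.1 < e.2) (he' : e'.1 < e'.2)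
    (hne : e' ≠ e) {c : V → V → ℝ} (hc : ∀ x y, c x y ∈ Set.Icc (0 : ℝ) 1) :
    Separable₂ e.1 e.2 (fun v : I → V => c (v e'.1) (v e'.2)) := by
  intro v
  by_cases h2 : e'.1 ≠ e.2 ∧ e'.2 ≠ e.2
  · refine ⟨fun x => c (Function.update v e.1 x e'.1) (Function.update v e.1 x e'.2),
      fun _ => 1, fun x => hc _ _, by simp, fun x y => ?_⟩
    simp [Function.update_of_ne h2.1, Function.update_of_ne h2.2]
  · have h1 : e'.1 ≠ e.1 ∧ e'.2 ≠ e.1 := by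
      constructor
      · intro h
        refine h2 ⟨by rw [h]; exact he.ne, fun h' => hne (Prod.ext h h')⟩
      · intro h
        refine h2 ⟨fun h' => ?_, by rw [h]; exact he.ne⟩
        rw [h, h'] at he'
        exact lt_asymm he he'
    refine ⟨fun _ => 1, fun y => c (Function.update v e.2 y e'.1) (Function.update v e.2 y e'.2),
      by simp, fun y => hc _ _, fun x y => ?_⟩
    rw [Function.update_comm he.ne]
    simp [Function.update_of_ne h1.1, Function.update_of_ne h1.2]

variable [Fintype V] [Fintype I]

lemma sum_sum_update (i : I) (F : (I → V) → ℝ) :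
    ∑ v : I → V, ∑ x, F (Function.update v i x) = Fintype.card V * ∑ v, F v := by
  have hinv : Function.Involutive
      (fun q : (I → V) × V => (Function.update q.1 i q.2, q.1 i)) := by
    rintro ⟨v, x⟩
    simp
  rw [← Fintype.sum_prod_type' (f := fun v x => F (Function.update v i x)),
    ← Equiv.sum_comp hinv.toPerm (fun q => F (Function.update q.1 i q.2))]
  simp only [Function.Involutive.coe_toPerm, Function.update_idem, Function.update_eq_self]
  rw [Fintype.sum_prod_type]
  simp [Finset.mul_sum]

/-- Replacing one edge factor by a factor that is close in cut norm. -/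
lemma abs_sum_mul_sub_le {c : V → V → ℝ} {δ : ℝ}
    (hcut : ∀ a b : V → ℝ, (∀ u, a u ∈ Set.Icc (0 : ℝ) 1) → (∀ u, b u ∈ Set.Icc (0 : ℝ) 1) →
      |∑ u, ∑ v, a u * b v * c u v| ≤ δ * (Fintype.card V : ℝ) ^ 2)
    (hV : 0 < Fintype.card V) {i j : I} (hij : i ≠ j) {R : (I → V) → ℝ}
    (hR : Separable₂ i j R) :
    |∑ v : I → V, R v * c (v i) (v j)| ≤ δ * (Fintype.card V : ℝ) ^ Fintype.card I := by
  set m : ℝ := (Fintype.card V : ℝ) with hm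
  have hm0 : 0 < m := by rw [hm]; exact_mod_cast hV
  have h1 : m ^ 2 * ∑ v : I → V, R v * c (v i) (v j) = ∑ v : I → V, ∑ x, ∑ y,
      R (Function.update (Function.update v i x) j y) * c x y := by
    rw [sq, mul_assoc, ← sum_sum_update j, ← sum_sum_update i]
    refine Finset.sum_congr rfl fun v _ => Finset.sum_congr rfl fun x _ =>
      Finset.sum_congr rfl fun y _ => ?_
    simp [Function.update_of_ne hij]
  have h2 : |∑ v : I → V, ∑ x, ∑ y,
      R (Function.update (Function.update v i x) j y) * c x y| ≤
      m ^ Fintype.card I * (δ * m ^ 2) := by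
    refine (Finset.abs_sum_le_sum_abs _ _).trans ?_
    refine (Finset.sum_le_card_nsmul _ _ (δ * m ^ 2) fun v _ => ?_).trans ?_
    · obtain ⟨a, b, ha, hb, hab⟩ := hR v
      simp only [hab]
      exact hcut a b ha hb
    · simp [hm]
  rw [← h1, abs_mul, abs_of_pos (by positivity : 0 < m ^ 2)] at h2
  have h3 : m ^ 2 * |∑ v : I → V, R v * c (v i) (v j)| ≤
      m ^ 2 * (δ * m ^ Fintype.card I) := by linarith
  exact le_of_mul_le_mul_left h3 (by positivity)

lemma abs_sum_prod_sub_prod_le [PartialOrder I] {δ : ℝ} (hV : 0 < Fintype.card V)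
    {c d : I × I → V → V → ℝ} (hc : ∀ e x y, c e x y ∈ Set.Icc (0 : ℝ) 1)
    (hd : ∀ e x y, d e x y ∈ Set.Icc (0 : ℝ) 1)
    (hcut : ∀ e, ∀ a b : V → ℝ, (∀ u, a u ∈ Set.Icc (0 : ℝ) 1) →
      (∀ u, b u ∈ Set.Icc (0 : ℝ) 1) →
      |∑ u, ∑ v, a u * b v * (c e u v - d e u v)| ≤ δ * (Fintype.card V : ℝ) ^ 2)
    (E : Finset (I × I)) (hE : ∀ e ∈ E, e.1 < e.2) (R : (I → V) → ℝ)
    (hR : ∀ e ∈ E, Separable₂ e.1 e.2 R) :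
    |∑ v : I → V, R v * (∏ e ∈ E, c e (v e.1) (v e.2) - ∏ e ∈ E, d e (v e.1) (v e.2))| ≤
      E.card * (δ * (Fintype.card V : ℝ) ^ Fintype.card I) := by
  induction E using Finset.induction generalizing R with
  | empty => simp
  | insert e E he ih =>
    have hlt : e.1 < e.2 := hE e (Finset.mem_insert_self _ _)
    have hE' : ∀ e' ∈ E, e'.1 < e'.2 := fun e' h => hE e' (Finset.mem_insert_of_mem h)
    have hne : ∀ e' ∈ E, e' ≠ e := fun e' h h' => he (h' ▸ h)
    have i1 := ih hE' (fun v => R v * c e (v e.1) (v e.2)) fun e' h =>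
      (hR e' (Finset.mem_insert_of_mem h)).mul
        (separable₂_edge (hE' e' h) hlt (hne e' h).symm (hc e))
    have i2 := abs_sum_mul_sub_le (hcut e) hV hlt.ne
      (R := fun v => R v * ∏ e' ∈ E, d e' (v e'.1) (v e'.2))
      ((hR e (Finset.mem_insert_self _ _)).mul (Separable₂.prod E fun e' h =>
        separable₂_edge hlt (hE' e' h) (hne e' h) (hd e')))
    rw [Finset.card_insert_of_notMem he]
    push_cast
    rw [add_one_mul]
    refine le_trans (le_of_eq ?_) ((abs_add_le _ _).trans (add_le_add i1 i2))
    rw [← Finset.sum_add_distrib]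
    congr 1
    refine Finset.sum_congr rfl fun v _ => ?_
    rw [Finset.prod_insert he, Finset.prod_insert he]
    ring

end Swap

lemma abs_prod_sub_prod_le_sum {ι : Type*} (s : Finset ι) {a b : ι → ℝ}
    (ha : ∀ i, a i ∈ Set.Icc (0 : ℝ) 1) (hb : ∀ i, b i ∈ Set.Icc (0 : ℝ) 1) :
    |∏ i ∈ s, a i - ∏ i ∈ s, b i| ≤ ∑ i ∈ s, |a i - b i| := by
  induction s using Finset.induction with
  | empty => simp
  | insert i s hi ih =>
    rw [Finset.prod_insert hi, Finset.prod_insert hi, Finset.sum_insert hi]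
    have h1 : a i * ∏ x ∈ s, a x - b i * ∏ x ∈ s, b x =
        (a i - b i) * ∏ x ∈ s, a x + b i * (∏ x ∈ s, a x - ∏ x ∈ s, b x) := by ring
    rw [h1]
    refine (abs_add_le _ _).trans (add_le_add ?_ ?_)
    · rw [abs_mul]
      refine mul_le_of_le_one_right (abs_nonneg _) ?_
      rw [abs_of_nonneg (Finset.prod_nonneg fun i _ => (ha i).1)]
      exact Finset.prod_le_one (fun i _ => (ha i).1) fun i _ => (ha i).2
    · rw [abs_mul, abs_of_nonneg (hb i).1]
      exact (mul_le_of_le_one_left (abs_nonneg _) (hb i).2).trans ih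

lemma map_pair_pi {ι : Type*} [Fintype ι] {α : ι → Type*} [∀ i, MeasurableSpace (α i)]
    (μ : ∀ i, Measure (α i)) [∀ i, IsProbabilityMeasure (μ i)] {i j : ι} (hij : i ≠ j) :
    (Measure.pi μ).map (fun p => (p i, p j)) = (μ i).prod (μ j) := by
  have h := (ProbabilityTheory.iIndepFun_pi (μ := μ) (X := fun i (x : α i) => x)
    (fun i => aemeasurable_id)).indepFun hij
  rw [ProbabilityTheory.indepFun_iff_map_prod_eq_prod_map_map
    (measurable_pi_apply i).aemeasurable (measurable_pi_apply j).aemeasurable] at h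
  rw [h, (measurePreserving_eval μ i).map_eq, (measurePreserving_eval μ j).map_eq]

/-- Strict lexicographic order on binary sequences. -/
def LexLT (x y : ℕ → Bool) : Prop :=
  ∃ r, (∀ s < r, x s = y s) ∧ x r = false ∧ y r = true

/-- The probability that an edge of weight `w` is present (if `b`) or absent (if not `b`). -/
def edgeWeight (b : Prop) (w : ℝ) : ℝ := if b then w else 1 - w

lemma edgeWeight_mem (b : Prop) {w : ℝ} (hw : w ∈ Set.Icc (0 : ℝ) 1) :
    edgeWeight b w ∈ Set.Icc (0 : ℝ) 1 := by
  unfold edgeWeight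
  split_ifs
  · exact hw
  · exact ⟨by linarith [hw.2], by linarith [hw.1]⟩

lemma abs_edgeWeight_sub (b : Prop) (w u : ℝ) :
    |edgeWeight b w - edgeWeight b u| = |w - u| := by
  unfold edgeWeight
  split_ifs
  · rfl
  · rw [← abs_neg]; congr 1; ring

lemma continuous_edgeWeight (b : Prop) : Continuous (edgeWeight b) := by
  unfold edgeWeight
  split_ifs <;> fun_prop

lemma iff_of_edgeWeight_adjInd_ne_zero {n : ℕ} {G : SimpleGraph (Fin n)} {u v : Fin n} {b : Prop}
    (h : edgeWeight b (adjInd G u v) ≠ 0) : G.Adj u v ↔ b := by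
  unfold edgeWeight adjInd at h
  by_cases hb : b <;> by_cases hG : G.Adj u v <;> simp_all

section Limit

variable {n : ℕ → ℕ} [∀ k, NeZero (n k)] {G : ∀ k, SimpleGraph (Fin (n k))}
  {x : ∀ k, Fin (n k) → ℕ → Bool}

lemma sum_indicator_prod_le_badCount (H : ∀ n, Set (SimpleGraph (Fin n))) {m N : ℕ}
    (G : SimpleGraph (Fin m)) (x : Fin m → ℕ → Bool)
    (hx : ∀ u v, LexLT (x u) (x v) → u < v) (D : Fin N → Set (ℕ → Bool))
    (hlex : ∀ i j, i < j → ∀ a ∈ D i, ∀ b ∈ D j, LexLT a b)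
    (F : SimpleGraph (Fin N)) (hF : F ∉ H N) (E : Finset (Fin N × Fin N))
    (hE : ∀ i j, i < j → (i, j) ∈ E) :
    ∑ v : Fin N → Fin m, (∏ l, (D l).indicator (fun _ => (1 : ℝ)) (x (v l))) *
      ∏ e ∈ E, edgeWeight (F.Adj e.1 e.2) (adjInd G (v e.1) (v e.2)) ≤ badCount H G N := by
  rw [badCount, Finset.card_filter]
  push_cast
  refine Finset.sum_le_sum fun v _ => ?_
  have hmem : ∀ e : Fin N × Fin N,
      edgeWeight (F.Adj e.1 e.2) (adjInd G (v e.1) (v e.2)) ∈ Set.Icc (0 : ℝ) 1 := fun e =>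
    edgeWeight_mem _ ⟨adjInd_nonneg _ _ _, adjInd_le_one _ _ _⟩
  have hind : ∀ l, (D l).indicator (fun _ => (1 : ℝ)) (x (v l)) ∈ Set.Icc (0 : ℝ) 1 := fun l => by
    by_cases h : x (v l) ∈ D l <;> simp [h]
  split_ifs with hgood
  swap
  · exact mul_le_one₀ (Finset.prod_le_one (fun l _ => (hind l).1) fun l _ => (hind l).2)
      (Finset.prod_nonneg fun e _ => (hmem e).1)
      (Finset.prod_le_one (fun e _ => (hmem e).1) fun e _ => (hmem e).2)
  · refine le_of_eq ?_
    by_contra hne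
    obtain ⟨h1, h2⟩ := mul_ne_zero_iff.1 hne
    rw [Finset.prod_ne_zero_iff] at h1 h2
    have hv : StrictMono v := fun i j hij => hx _ _ (hlex i j hij _
      (Set.mem_of_indicator_ne_zero (h1 i (Finset.mem_univ _))) _
      (Set.mem_of_indicator_ne_zero (h1 j (Finset.mem_univ _))))
    refine hF ?_
    have hcomap : G.comap v = F := by
      have key : ∀ i j, i < j → (G.Adj (v i) (v j) ↔ F.Adj i j) := fun i j hij =>
        iff_of_edgeWeight_adjInd_ne_zero (h2 (i, j) (hE i j hij))
      ext i j
      rw [SimpleGraph.comap_adj]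
      rcases lt_trichotomy i j with h | h | h
      · exact key i j h
      · subst h; simp
      · rw [G.adj_comm, F.adj_comm]; exact key j i h
    rw [← hcomap]
    exact (inducedIn_image_iff G v hv).1 hgood

lemma LimitObject.integral_le_zero {H : ∀ n, Set (SimpleGraph (Fin n))} (L : LimitObject G x)
    (hx : ∀ k u v, LexLT (x k u) (x k v) → u < v) {N : ℕ}
    (hbad : Tendsto (fun k => (badCount H (G k) N : ℝ) / (n k : ℝ) ^ N) atTop (nhds 0))
    (D : Fin N → Set (ℕ → Bool)) (hD : ∀ i, IsClopen (D i))
    (hlex : ∀ i j, i < j → ∀ a ∈ D i, ∀ b ∈ D j, LexLT a b)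
    (F : SimpleGraph (Fin N)) (hF : F ∉ H N) (E : Finset (Fin N × Fin N))
    (hE : ∀ i j, i < j ↔ (i, j) ∈ E) :
    ∫ p, (∏ l, (D l).indicator (fun _ => (1 : ℝ)) (p l).1) *
      ∏ e ∈ E, edgeWeight (F.Adj e.1 e.2) (L.W (p e.1, p e.2))
        ∂(Measure.pi fun _ : Fin N => (L.μ : Measure Label)) ≤ 0 := by
  set P := Measure.pi fun _ : Fin N => (L.μ : Measure Label) with hP
  set ρ : (Fin N → Label) → ℝ := fun p => ∏ l, (D l).indicator (fun _ => (1 : ℝ)) (p l).1 with hρ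
  have hindc : ∀ l, Continuous ((D l).indicator (fun _ => (1 : ℝ))) := fun l =>
    continuous_const.indicator fun a ha => by simp [(hD l).frontier_eq] at ha
  have hρc : Continuous ρ := by
    refine continuous_finsetProd _ fun l _ => (hindc l).comp ?_
    fun_prop
  have hind : ∀ l y, (D l).indicator (fun _ => (1 : ℝ)) y ∈ Set.Icc (0 : ℝ) 1 := fun l y => by
    by_cases h : y ∈ D l <;> simp [h]
  have hρ1 : ∀ p, ρ p ∈ Set.Icc (0 : ℝ) 1 := fun p =>
    ⟨Finset.prod_nonneg fun l _ => (hind l _).1,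
      Finset.prod_le_one (fun l _ => (hind l _).1) fun l _ => (hind l _).2⟩
  have hWm := L.measurable_W
  have ewm : ∀ b, Measurable (edgeWeight b) := fun b => (continuous_edgeWeight b).measurable
  have bint : ∀ {f : (Fin N → Label) → ℝ}, Measurable f → (∀ p, |f p| ≤ 1) → Integrable f P :=
    fun hf h1 => Integrable.of_bound hf.aestronglyMeasurable 1 (ae_of_all _ h1)
  refine le_of_forall_pos_le_add fun η hη => ?_
  set δ := η / (2 * (E.card + 1)) with hδ
  have hδ0 : 0 < δ := by positivity
  obtain ⟨U, hWU, hcut⟩ := L.cut δ hδ0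
  have hUc : Continuous fun p => (U p : ℝ) := continuous_subtype_val.comp U.continuous
  have hwW : ∀ (p : Fin N → Label) (e : Fin N × Fin N),
      edgeWeight (F.Adj e.1 e.2) (L.W (p e.1, p e.2)) ∈ Set.Icc (0 : ℝ) 1 := fun p e =>
    edgeWeight_mem _ (L.W_mem _)
  have hwU : ∀ (p : Fin N → Label) (e : Fin N × Fin N),
      edgeWeight (F.Adj e.1 e.2) (U (p e.1, p e.2)) ∈ Set.Icc (0 : ℝ) 1 := fun p e =>
    edgeWeight_mem _ (U _).2
  have hprod : ∀ {g : (Fin N → Label) → Fin N × Fin N → ℝ} (p), (∀ p e, g p e ∈ Set.Icc (0 : ℝ) 1) →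
      |ρ p * ∏ e ∈ E, g p e| ≤ 1 := fun {g} p hg => by
    have h0 := Finset.prod_nonneg (s := E) fun e _ => (hg p e).1
    rw [abs_of_nonneg (mul_nonneg (hρ1 p).1 h0)]
    exact mul_le_one₀ (hρ1 p).2 h0 (Finset.prod_le_one (fun e _ => (hg p e).1) fun e _ => (hg p e).2)
  set fU : C(Fin N → Label, ℝ) := ⟨fun p => ρ p *
      ∏ e ∈ E, edgeWeight (F.Adj e.1 e.2) (U (p e.1, p e.2)), by
    refine hρc.mul (continuous_finsetProd _ fun e _ => (continuous_edgeWeight _).comp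
      (hUc.comp ?_))
    fun_prop⟩ with hfU
  set fW : (Fin N → Label) → ℝ := fun p => ρ p *
      ∏ e ∈ E, edgeWeight (F.Adj e.1 e.2) (L.W (p e.1, p e.2)) with hfW
  have hfWm : Measurable fW := by
    refine hρc.measurable.mul (Finset.measurable_prod _ fun e _ => (ewm _).comp (hWm.comp ?_))
    fun_prop
  have hstep1 : ∫ p, fW p ∂P ≤ ∫ p, fU p ∂P + E.card * δ := by
    have hle : ∀ p, fW p ≤ fU p + ∑ e ∈ E, |L.W (p e.1, p e.2) - U (p e.1, p e.2)| := fun p => by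
      have h1 := abs_prod_sub_prod_le_sum E (hwW p) (hwU p)
      simp only [abs_edgeWeight_sub] at h1
      have h2 : fW p - fU p = ρ p * (∏ e ∈ E, edgeWeight (F.Adj e.1 e.2) (L.W (p e.1, p e.2)) -
          ∏ e ∈ E, edgeWeight (F.Adj e.1 e.2) (U (p e.1, p e.2))) := by
        simp only [hfW, hfU, ContinuousMap.coe_mk]; ring
      have h3 : fW p - fU p ≤ |∏ e ∈ E, edgeWeight (F.Adj e.1 e.2) (L.W (p e.1, p e.2)) -
          ∏ e ∈ E, edgeWeight (F.Adj e.1 e.2) (U (p e.1, p e.2))| := by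
        rw [h2]
        refine (le_abs_self _).trans ?_
        rw [abs_mul, abs_of_nonneg (hρ1 p).1]
        exact mul_le_of_le_one_left (abs_nonneg _) (hρ1 p).2
      linarith
    have hdm : Measurable fun q => |L.W q - U q| := (hWm.sub hUc.measurable).abs
    have hd1 : ∀ q, |(|L.W q - U q|)| ≤ 1 := fun q => by
      rw [abs_abs]
      exact abs_le.2 ⟨by linarith [(L.W_mem q).1, (U q).2.2], by linarith [(L.W_mem q).2, (U q).2.1]⟩
    have hsi : ∀ e ∈ E, Integrable (fun p : Fin N → Label =>
        |L.W (p e.1, p e.2) - U (p e.1, p e.2)|) P := fun e _ =>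
      bint (hdm.comp (by fun_prop)) fun p => hd1 _
    have hfUi : Integrable fU P := bint fU.continuous.measurable fun p => hprod p hwU
    refine (integral_mono (bint hfWm fun p => hprod p hwW)
      (hfUi.add (integrable_finsetSum _ hsi)) hle).trans ?_
    simp only [Pi.add_apply]
    rw [integral_add hfUi (integrable_finsetSum _ hsi), integral_finsetSum _ hsi]
    refine add_le_add le_rfl ?_
    rw [← nsmul_eq_mul]
    refine Finset.sum_le_card_nsmul _ _ _ fun e he => ?_
    have hne : e.1 ≠ e.2 := ((hE e.1 e.2).2 he).ne
    have := map_pair_pi (fun _ : Fin N => (L.μ : Measure Label)) hne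
    refine le_trans (le_of_eq ?_) hWU
    rw [← this, integral_map (by fun_prop) hdm.aestronglyMeasurable]
  have hstep2 : ∫ p, fU p ∂P ≤ E.card * δ := by
    have t1 := tendsto_pi_average L.lim N fU
    have t2 := ((hbad.mono_left (Nat.hyperfilter_le_atTop)).const_add (E.card * δ))
    rw [add_zero] at t2
    refine le_of_tendsto_of_tendsto t1 t2 ?_
    filter_upwards [hcut] with k hk
    have hn : (0 : ℝ) < (n k : ℝ) ^ N := by
      have := NeZero.pos (n k)
      positivity
    rw [div_le_iff₀ hn, add_mul, div_mul_cancel₀ _ hn.ne']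
    have hx' : ∀ v, (L.φ k v).1 = x k v := L.fst_φ k
    have hbc := sum_indicator_prod_le_badCount H (G k) (x k) (hx k) D hlex F hF E
      fun i j h => (hE i j).1 h
    have hsw := abs_sum_prod_sub_prod_le (V := Fin (n k)) (I := Fin N) (δ := δ)
      (by simpa using NeZero.pos (n k))
      (c := fun e u v => edgeWeight (F.Adj e.1 e.2) (adjInd (G k) u v))
      (d := fun e u v => edgeWeight (F.Adj e.1 e.2) (U (L.φ k u, L.φ k v)))
      (fun e u v => edgeWeight_mem _ ⟨adjInd_nonneg _ _ _, adjInd_le_one _ _ _⟩)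
      (fun e u v => edgeWeight_mem _ (U _).2)
      (fun e a b ha hb => by
        have h1 := hk a b ha hb
        simp only [Fintype.card_fin]
        unfold edgeWeight
        split_ifs
        · exact h1
        · rw [← abs_neg, ← Finset.sum_neg_distrib]
          refine le_trans (le_of_eq ?_) h1
          congr 1
          refine Finset.sum_congr rfl fun u _ => ?_
          rw [← Finset.sum_neg_distrib]
          refine Finset.sum_congr rfl fun v _ => ?_
          ring)
      E (fun e he => (hE e.1 e.2).2 he)
      (fun v => ∏ l, (D l).indicator (fun _ => (1 : ℝ)) (x k (v l)))
      (fun e he => Separable₂.prod _ fun l _ =>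
        separable₂_vertex ((hE e.1 e.2).2 he).ne l (w := fun u => (D l).indicator (fun _ => (1 : ℝ))
          (x k u)) fun u => hind l _)
    simp only [Fintype.card_fin, mul_sub, Finset.sum_sub_distrib] at hsw
    have h3 := (abs_le.1 hsw).1
    simp only [hfU, hρ, ContinuousMap.coe_mk, hx']
    linarith
  have hη' : (E.card : ℝ) * δ + E.card * δ ≤ η := by
    rw [hδ]
    have : (0:ℝ) ≤ E.card := Nat.cast_nonneg _
    rw [← two_mul, ← mul_assoc, mul_div_assoc', div_le_iff₀ (by positivity)]
    nlinarith
  linarith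

/-- If copies of graphs outside `H` have vanishing density, then almost every sample of the limit
whose positions lie in increasing cylinders only supports graphs in `H`. -/
lemma LimitObject.ae_mem {H : ∀ n, Set (SimpleGraph (Fin n))} (L : LimitObject G x)
    (hx : ∀ k u v, LexLT (x k u) (x k v) → u < v) {N : ℕ}
    (hbad : Tendsto (fun k => (badCount H (G k) N : ℝ) / (n k : ℝ) ^ N) atTop (nhds 0))
    (D : Fin N → Set (ℕ → Bool)) (hD : ∀ i, IsClopen (D i))
    (hlex : ∀ i j, i < j → ∀ a ∈ D i, ∀ b ∈ D j, LexLT a b) :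
    ∀ᵐ p ∂(Measure.pi fun _ : Fin N => (L.μ : Measure Label)), (∀ i, (p i).1 ∈ D i) →
      ∀ F : SimpleGraph (Fin N),
        (∀ i j, i < j → 0 < edgeWeight (F.Adj i j) (L.W (p i, p j))) → F ∈ H N := by
  set E : Finset (Fin N × Fin N) := Finset.univ.filter fun e => e.1 < e.2 with hEdef
  have hE : ∀ i j, i < j ↔ (i, j) ∈ E := fun i j => by simp [hEdef]
  have key : ∀ F : SimpleGraph (Fin N), F ∉ H N →
      ∀ᵐ p ∂(Measure.pi fun _ : Fin N => (L.μ : Measure Label)),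
        (∏ l, (D l).indicator (fun _ => (1 : ℝ)) (p l).1) *
          ∏ e ∈ E, edgeWeight (F.Adj e.1 e.2) (L.W (p e.1, p e.2)) = 0 := fun F hF => by
    have h0 := L.integral_le_zero hx hbad D hD hlex F hF E hE
    have hmemI : ∀ l y, (D l).indicator (fun _ => (1 : ℝ)) y ∈ Set.Icc (0 : ℝ) 1 := fun l y => by
      by_cases h : y ∈ D l <;> simp [h]
    have hnn : ∀ p : Fin N → Label, 0 ≤ (∏ l, (D l).indicator (fun _ => (1 : ℝ)) (p l).1) *
        ∏ e ∈ E, edgeWeight (F.Adj e.1 e.2) (L.W (p e.1, p e.2)) := fun p =>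
      mul_nonneg (Finset.prod_nonneg fun l _ => (hmemI l _).1)
        (Finset.prod_nonneg fun e _ => (edgeWeight_mem _ (L.W_mem _)).1)
    refine (integral_eq_zero_iff_of_nonneg hnn ?_).1 (le_antisymm h0 (integral_nonneg hnn))
    refine Integrable.of_bound (C := 1) (Measurable.aestronglyMeasurable ?_) (ae_of_all _ fun p => ?_)
    · refine (Finset.measurable_prod _ fun l _ => ?_).mul (Finset.measurable_prod _ fun e _ =>
        (continuous_edgeWeight _).measurable.comp (L.measurable_W.comp (by fun_prop)))
      exact ((measurable_const (a := (1 : ℝ))).indicator (hD l).isClosed.measurableSet).comp (by fun_prop)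
    · rw [Real.norm_eq_abs, abs_of_nonneg (hnn p)]
      exact mul_le_one₀ (Finset.prod_le_one (fun l _ => (hmemI l _).1) fun l _ => (hmemI l _).2)
        (Finset.prod_nonneg fun e _ => (edgeWeight_mem _ (L.W_mem _)).1)
        (Finset.prod_le_one (fun e _ => (edgeWeight_mem _ (L.W_mem _)).1)
          fun e _ => (edgeWeight_mem _ (L.W_mem _)).2)
  have hall : ∀ᵐ p ∂(Measure.pi fun _ : Fin N => (L.μ : Measure Label)),
      ∀ F : SimpleGraph (Fin N), F ∉ H N →
        (∏ l, (D l).indicator (fun _ => (1 : ℝ)) (p l).1) *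
          ∏ e ∈ E, edgeWeight (F.Adj e.1 e.2) (L.W (p e.1, p e.2)) = 0 := by
    rw [ae_all_iff]
    intro F
    by_cases hF : F ∈ H N
    · exact ae_of_all _ fun p h => absurd hF h
    · filter_upwards [key F hF] with p hp _ using hp
  filter_upwards [hall] with p hp hpD F hpos
  by_contra hF
  refine absurd (hp F hF) (ne_of_gt (mul_pos ?_ ?_))
  · exact Finset.prod_pos fun l _ => by simp [hpD l]
  · exact Finset.prod_pos fun e he => hpos e.1 e.2 ((hE _ _).2 he)

end Limit

/-- The binary expansion of `v / n`. -/
def posBits (n v : ℕ) (i : ℕ) : Bool := decide (2 ^ (i + 1) * v / n % 2 = 1)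

lemma posBits_succ (n v r : ℕ) :
    2 ^ (r + 1) * v / n = 2 * (2 ^ r * v / n) + (if posBits n v r then 1 else 0) := by
  have h1 : 2 ^ (r + 1) * v / n / 2 = 2 ^ r * v / n := by
    rw [Nat.div_div_eq_div_mul, pow_succ, mul_comm (2 ^ r) 2, mul_assoc, mul_comm n 2,
      Nat.mul_div_mul_left _ _ two_pos]
  have h2 := Nat.div_add_mod (2 ^ (r + 1) * v / n) 2
  rw [h1] at h2
  have h3 := Nat.mod_lt (2 ^ (r + 1) * v / n) two_pos
  unfold posBits
  split_ifs with h <;> simp at h <;> omega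

lemma posBits_prefix_iff {n u v : ℕ} (hu : u < n) (hv : v < n) (r : ℕ) :
    (∀ i < r, posBits n u i = posBits n v i) ↔ 2 ^ r * u / n = 2 ^ r * v / n := by
  induction r with
  | zero => simp [Nat.div_eq_of_lt hu, Nat.div_eq_of_lt hv]
  | succ r ih =>
    rw [Nat.forall_lt_succ_right, ih, posBits_succ, posBits_succ n v]
    constructor
    · rintro ⟨h1, h2⟩
      rw [h1, h2]
    · intro h
      cases h1 : posBits n u r <;> cases h2 : posBits n v r <;> simp [h1, h2] at h ⊢ <;> omega

lemma lt_of_lexLT_posBits {n u v : ℕ} (hu : u < n) (hv : v < n)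
    (h : LexLT (posBits n u) (posBits n v)) : u < v := by
  obtain ⟨r, hr, h0, h1⟩ := h
  have e := (posBits_prefix_iff hu hv r).1 hr
  have s1 := posBits_succ n u r
  have s2 := posBits_succ n v r
  rw [h0] at s1
  rw [h1] at s2
  by_contra! hle
  have : 2 ^ (r + 1) * v / n ≤ 2 ^ (r + 1) * u / n := by gcongr
  simp at s1 s2
  omega

lemma posBits_prefix_or {n u v : ℕ} (huv : u < v) (hv : v < n) (m : ℕ) :
    (∀ i < m, posBits n u i = posBits n v i) ∨
      ∃ r < m, (∀ i < r, posBits n u i = posBits n v i) ∧ posBits n u r = false ∧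
        posBits n v r = true := by
  by_cases h : ∀ i < m, posBits n u i = posBits n v i
  · exact Or.inl h
  · right
    push Not at h
    set r := Nat.find h with hr
    obtain ⟨hrm, hne⟩ := Nat.find_spec h
    have hpre : ∀ i < r, posBits n u i = posBits n v i := fun i hi => by
      by_contra hc
      exact Nat.find_min h hi ⟨hi.trans hrm, hc⟩
    refine ⟨r, hrm, hpre, ?_⟩
    have e := (posBits_prefix_iff (huv.trans hv) hv r).1 hpre
    have s1 := posBits_succ n u r
    have s2 := posBits_succ n v r
    have : 2 ^ (r + 1) * u / n ≤ 2 ^ (r + 1) * v / n := by gcongr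
    rw [← hr] at hne
    cases h1 : posBits n u r <;> cases h2 : posBits n v r <;> simp [h1, h2] at *
    omega

lemma card_prefix_le {n m : ℕ} (hn : 0 < n) (c : ℕ → Bool) :
    ((Finset.univ.filter fun v : Fin n => ∀ i < m, posBits n v i = c i).card : ℝ) ≤
      n / 2 ^ m + 1 := by
  set S := Finset.univ.filter fun v : Fin n => ∀ i < m, posBits n v i = c i with hS
  rcases S.eq_empty_or_nonempty with h | ⟨w, hw⟩
  · rw [h]; simp; positivity
  set q := 2 ^ m * (w : ℕ) / n with hq
  have hsub : ∀ v ∈ S, 2 ^ m * (v : ℕ) / n = q := fun v hv => by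
    simp only [hS, Finset.mem_filter, Finset.mem_univ, true_and] at hv hw
    exact (posBits_prefix_iff v.2 w.2 m).1 fun i hi => (hv i hi).trans (hw i hi).symm
  have hne : S.Nonempty := ⟨w, hw⟩
  set a := S.min' hne with ha
  have hcard : S.card ≤ (S.max' hne : ℕ) - a + 1 := by
    have h1 : S.image Fin.val ⊆ Finset.Icc (a : ℕ) (S.max' hne) := by
      intro x hx
      obtain ⟨v, hv, rfl⟩ := Finset.mem_image.1 hx
      exact Finset.mem_Icc.2 ⟨S.min'_le v hv, S.le_max' v hv⟩
    have h2 := Finset.card_le_card h1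
    rw [Finset.card_image_of_injective _ Fin.val_injective, Nat.card_Icc] at h2
    have : (a : ℕ) ≤ S.max' hne := S.min'_le _ (S.max'_mem hne)
    omega
  have hmax := hsub _ (S.max'_mem hne)
  have hmin := hsub _ (S.min'_mem hne)
  have h3 : 2 ^ m * ((S.max' hne : ℕ) - a) ≤ n := by
    have i1 := Nat.lt_mul_div_succ (2 ^ m * (S.max' hne : ℕ)) hn
    have i2 := Nat.mul_div_le (2 ^ m * (a : ℕ)) n
    rw [hmax] at i1
    rw [hmin] at i2
    rw [Nat.mul_sub]
    have : n * (q + 1) = n * q + n := by ring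
    omega
  have h4 : (S.card : ℝ) ≤ (((S.max' hne : ℕ) - a : ℕ) : ℝ) + 1 := by exact_mod_cast hcard
  have h5 : (2 : ℝ) ^ m * (((S.max' hne : ℕ) - a : ℕ) : ℝ) ≤ n := by exact_mod_cast h3
  refine h4.trans (add_le_add ?_ le_rfl)
  rw [le_div_iff₀ (by positivity)]
  linarith

/-- The fair coin measure on the Cantor space. -/
def coin : Measure (ℕ → Bool) :=
  Measure.infinitePi fun _ => (unifMeasure Bool : Measure Bool)

instance : IsProbabilityMeasure coin := inferInstanceAs (IsProbabilityMeasure (Measure.infinitePi _))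

lemma unifMeasure_bool (b : Bool) : (unifMeasure Bool : Measure Bool) {b} = 2⁻¹ := by
  rw [unifMeasure, ProbabilityMeasure.coe_mk, ProbabilityTheory.uniformOn_univ]
  simp

lemma coin_cylinder (B : Finset ℕ) (c : ℕ → Bool) : coin {z | ∀ i ∈ B, z i = c i} = 2⁻¹ ^ B.card := by
  have : {z : ℕ → Bool | ∀ i ∈ B, z i = c i} = Set.pi B fun i => {c i} := by
    ext z; simp
  rw [this, coin, Measure.infinitePi_pi _ fun _ _ => MeasurableSet.singleton _]
  simp [unifMeasure_bool]

lemma eq_coin_of_cylinder_le {ν : Measure (ℕ → Bool)} [IsProbabilityMeasure ν]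
    (h : ∀ m (c : ℕ → Bool), ν {z | ∀ i < m, z i = c i} ≤ 2⁻¹ ^ m) : ν = coin := by
  refine Measure.eq_infinitePi _ fun s t ht => ?_
  rw [← Measure.infinitePi_pi (μ := fun _ : ℕ => (unifMeasure Bool : Measure Bool)) fun i _ => ht i]
  change ν _ = coin _
  obtain ⟨m, hm⟩ : ∃ m, ∀ i ∈ s, i < m := ⟨s.sup id + 1, fun i hi =>
    Nat.lt_succ_of_le (Finset.le_sup (f := id) hi)⟩
  set r : (ℕ → Bool) → Fin m → Bool := fun z i => z i with hr
  have hrm : Measurable r := by fun_prop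
  have hmap : ν.map r = coin.map r := by
    have : IsProbabilityMeasure (ν.map r) := Measure.isProbabilityMeasure_map hrm.aemeasurable
    have : IsProbabilityMeasure (coin.map r) := Measure.isProbabilityMeasure_map hrm.aemeasurable
    refine Measure.eq_of_le_of_measure_univ_eq ?_ (by simp)
    refine Measure.le_iff.2 fun S _ => ?_
    rw [← Set.coe_toFinset S, ← sum_measure_singleton, ← sum_measure_singleton]
    refine Finset.sum_le_sum fun d _ => ?_
    rw [Measure.map_apply hrm (MeasurableSet.singleton _),
      Measure.map_apply hrm (MeasurableSet.singleton _)]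
    set c : ℕ → Bool := fun i => if h : i < m then d ⟨i, h⟩ else false with hc
    have e : r ⁻¹' {d} = {z | ∀ i < m, z i = c i} := by
      ext z
      simp only [Set.mem_preimage, Set.mem_singleton_iff, Set.mem_ofPred_eq, hr, hc, funext_iff]
      constructor
      · intro h i hi
        rw [dif_pos hi, ← h ⟨i, hi⟩]
      · intro h i
        rw [h i i.2, dif_pos i.2]
    have e' : coin {z | ∀ i < m, z i = c i} = 2⁻¹ ^ m := by
      simpa using coin_cylinder (Finset.range m) c
    rw [e, e']
    exact h m c
  have hpre : Set.pi (s : Set ℕ) t = r ⁻¹' {d | ∀ i (h : i ∈ s), d ⟨i, hm i h⟩ ∈ t i} := by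
    ext z; simp [hr, Set.mem_pi]
  rw [hpre, ← Measure.map_apply hrm (Set.toFinite _).measurableSet, hmap,
    Measure.map_apply hrm (Set.toFinite _).measurableSet]

lemma isClopen_cylinder (m : ℕ) (c : ℕ → Bool) : IsClopen {z : ℕ → Bool | ∀ i < m, z i = c i} := by
  have : {z : ℕ → Bool | ∀ i < m, z i = c i} =
      ⋂ i ∈ Finset.range m, (fun z : ℕ → Bool => z i) ⁻¹' {c i} := by
    ext z; simp
  rw [this]
  exact isClopen_biInter_finset fun i _ => (isClopen_discrete _).preimage (continuous_apply i)

lemma LimitObject.map_fst_eq_coin {n : ℕ → ℕ} [∀ k, NeZero (n k)]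
    {G : ∀ k, SimpleGraph (Fin (n k))} (hn : ∀ k, k + 1 ≤ n k)
    (L : LimitObject G fun k v => posBits (n k) v) :
    (L.μ : Measure Label).map Prod.fst = coin := by
  have : IsProbabilityMeasure ((L.μ : Measure Label).map Prod.fst) :=
    Measure.isProbabilityMeasure_map measurable_fst.aemeasurable
  refine eq_coin_of_cylinder_le fun m c => ?_
  set C : Set (ℕ → Bool) := {z | ∀ i < m, z i = c i} with hC
  have hCc := isClopen_cylinder m c
  set h : C(Label × Label, ℝ) := ⟨fun p => C.indicator (fun _ => 1) p.1.1,
    (continuous_const.indicator fun a ha => by rw [hCc.frontier_eq] at ha; exact ha.elim).comp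
      (by fun_prop)⟩ with hh
  have hn' : Tendsto (fun k => (n k : ℝ)) atTop atTop :=
    tendsto_natCast_atTop_atTop.comp (tendsto_atTop_mono (fun k => (Nat.le_succ k).trans (hn k))
      tendsto_id)
  have t1 := tendsto_pair_average L.lim h
  have t2 : Tendsto (fun k => (2⁻¹ : ℝ) ^ m + (n k : ℝ)⁻¹) (hyperfilter ℕ : Filter ℕ)
      (nhds ((2⁻¹ : ℝ) ^ m + 0)) :=
    ((tendsto_inv_atTop_zero.comp hn').const_add _).mono_left Nat.hyperfilter_le_atTop
  have hle : ∫ p, h p ∂((L.μ : Measure Label).prod (L.μ : Measure Label)) ≤ (2⁻¹ : ℝ) ^ m := by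
    rw [add_zero] at t2
    refine le_of_tendsto_of_tendsto' t1 t2 fun k => ?_
    have hnk : 0 < n k := NeZero.pos (n k)
    have hnr : (0 : ℝ) < n k := by exact_mod_cast hnk
    have e : ∑ u, ∑ v, h (L.φ k u, L.φ k v) = n k *
        ((Finset.univ.filter fun v : Fin (n k) => ∀ i < m, posBits (n k) v i = c i).card : ℝ) := by
      rw [Finset.card_filter]
      push_cast
      rw [Finset.mul_sum]
      refine Finset.sum_congr rfl fun u _ => ?_
      simp [hh, L.fst_φ, Set.indicator_apply, hC]
    rw [e, div_le_iff₀ (by positivity)]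
    have := card_prefix_le (m := m) hnk c
    calc _ ≤ (n k : ℝ) * (n k / 2 ^ m + 1) := by gcongr
      _ = _ := by rw [inv_pow]; field_simp
  have h_int : ∫ p, h p ∂((L.μ : Measure Label).prod (L.μ : Measure Label)) =
      (L.μ : Measure Label).real (Prod.fst ⁻¹' C) := by
    have e := integral_fun_fst (μ := (L.μ : Measure Label)) (ν := (L.μ : Measure Label))
      (f := fun p : Label => C.indicator (fun _ => (1 : ℝ)) p.1)
    simp only [hh, ContinuousMap.coe_mk]
    rw [e]
    simp only [probReal_univ, one_smul]
    rw [← integral_indicator_one (hCc.isClosed.measurableSet.preimage measurable_fst)]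
    rfl
  rw [h_int] at hle
  rw [Measure.map_apply measurable_fst hCc.isClosed.measurableSet,
    ← ENNReal.ofReal_toReal (measure_ne_top (L.μ : Measure Label) _)]
  refine (ENNReal.ofReal_le_ofReal hle).trans (le_of_eq ?_)
  rw [ENNReal.ofReal_pow (by positivity), ENNReal.ofReal_inv_of_pos two_pos]
  simp

lemma card_same_prefix_le {n m : ℕ} (hn : 0 < n) :
    ((Finset.univ.filter fun p : Fin n × Fin n =>
      ∀ i < m, posBits n p.1 i = posBits n p.2 i).card : ℝ) ≤ n * (n / 2 ^ m + 1) := by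
  rw [Finset.card_filter, Fintype.sum_prod_type]
  push_cast
  refine (Finset.sum_le_card_nsmul _ _ (n / 2 ^ m + 1 : ℝ) fun u _ => ?_).trans
    (by rw [Finset.card_univ, Fintype.card_fin, nsmul_eq_mul])
  have := card_prefix_le (m := m) hn (posBits n u)
  rw [Finset.card_filter] at this
  push_cast at this
  simpa only [eq_comm] using this

/-- The sequence that agrees with `x` on `A` and with `z` elsewhere. -/
def splice (A : Set ℕ) (x z : ℕ → Bool) : ℕ → Bool := fun i => if i ∈ A then x i else z i

lemma measurable_splice (A : Set ℕ) :
    Measurable fun q : (ℕ → Bool) × (ℕ → Bool) => splice A q.1 q.2 := by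
  refine measurable_pi_iff.2 fun i => ?_
  unfold splice
  split_ifs <;> fun_prop

lemma map_splice_coin (A : Set ℕ) :
    (coin.prod coin).map (fun q => splice A q.1 q.2) = coin := by
  refine Measure.eq_infinitePi _ fun s t ht => ?_
  rw [Measure.map_apply (measurable_splice A) (MeasurableSet.pi s.countable_toSet fun i _ => ht i)]
  have e : (fun q : (ℕ → Bool) × (ℕ → Bool) => splice A q.1 q.2) ⁻¹' Set.pi (s : Set ℕ) t =
      Set.pi ((s.filter (· ∈ A) : Finset ℕ) : Set ℕ) t ×ˢ
        Set.pi ((s.filter (· ∉ A) : Finset ℕ) : Set ℕ) t := by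
    ext q
    simp only [Set.mem_preimage, Set.mem_pi, Set.mem_prod, Finset.mem_coe, Finset.mem_filter,
      splice, and_imp]
    constructor
    · intro h
      exact ⟨fun i hi hA => by simpa [hA] using h i hi, fun i hi hA => by simpa [hA] using h i hi⟩
    · rintro ⟨h1, h2⟩ i hi
      by_cases hA : i ∈ A
      · simpa [hA] using h1 i hi hA
      · simpa [hA] using h2 i hi hA
  rw [e, Measure.prod_prod, coin, Measure.infinitePi_pi _ fun i _ => ht i,
    Measure.infinitePi_pi _ fun i _ => ht i, Finset.prod_filter_mul_prod_filter_not]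

lemma map_overwrite_coin_le (B : Finset ℕ) (c : ℕ → Bool) :
    coin.map (fun z => splice B c z) ≤ (2 : ℝ≥0∞) ^ B.card • coin := by
  have hm : Measurable fun z => splice B c z :=
    (measurable_splice B).comp (measurable_const.prodMk measurable_id)
  refine Measure.le_iff.2 fun S hS => ?_
  have hsub : {x : ℕ → Bool | ∀ i ∈ B, x i = c i} ×ˢ ((fun z => splice B c z) ⁻¹' S) ⊆
      (fun q : (ℕ → Bool) × (ℕ → Bool) => splice B q.1 q.2) ⁻¹' S := by
    rintro ⟨x, z⟩ ⟨hx, hz⟩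
    have : splice B x z = splice B c z := by
      ext i
      unfold splice
      split_ifs with h
      · exact hx i h
      · rfl
    simpa [this] using hz
  have h1 := measure_mono (μ := coin.prod coin) hsub
  rw [Measure.prod_prod, coin_cylinder, ← Measure.map_apply hm hS,
    ← Measure.map_apply (measurable_splice B) hS, map_splice_coin] at h1
  rw [Measure.smul_apply, smul_eq_mul]
  calc coin.map (fun z => splice B c z) S
      = 2 ^ B.card * (2⁻¹ ^ B.card * coin.map (fun z => splice B c z) S) := by
        rw [← mul_assoc, ← mul_pow, ENNReal.mul_inv_cancel two_ne_zero ENNReal.ofNat_ne_top,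
          one_pow, one_mul]
    _ ≤ _ := by gcongr

/-- The standard probability space that parametrizes labels with a given position. -/
abbrev Seed : Type := (ℕ → Bool) × unitInterval

/-- The uniform measure on seeds. -/
def seedMeasure : Measure Seed := coin.prod volume

instance : IsProbabilityMeasure seedMeasure :=
  inferInstanceAs (IsProbabilityMeasure (coin.prod (volume : Measure unitInterval)))

lemma exists_seed_representation (μ : Measure Label) [IsProbabilityMeasure μ]
    (hμ : μ.map Prod.fst = coin) :
    ∃ g : Seed → Label, Measurable g ∧ (∀ ω, (g ω).1 = ω.1) ∧ seedMeasure.map g = μ := by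
  obtain ⟨γ, hγ, hγκ⟩ :=
    ProbabilityTheory.Kernel.exists_measurable_map_eq_unitInterval μ.condKernel
  have hg : Measurable fun ω : Seed => ((ω.1, γ ω.1 ω.2) : Label) :=
    measurable_fst.prodMk hγ
  refine ⟨_, hg, fun _ => rfl, ?_⟩
  have hd := μ.disintegrate μ.condKernel
  rw [Measure.fst, hμ] at hd
  rw [← hd]
  ext S hS
  rw [Measure.map_apply hg hS, seedMeasure, Measure.prod_apply (hg hS),
    Measure.compProd_apply hS]
  refine lintegral_congr fun x => ?_
  rw [← hγκ x, Measure.map_apply (by fun_prop) (measurable_prodMk_left hS)]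
  rfl

lemma tendsto_integral_abs_comp_sub {Y S : Type*} [TopologicalSpace Y] [NormalSpace Y]
    [MeasurableSpace Y] [BorelSpace Y] [MeasurableSpace S] {ρ : Measure Y}
    [IsProbabilityMeasure ρ] [ρ.WeaklyRegular] {σ : Measure S} [IsProbabilityMeasure σ]
    {T : ℕ → S → Y} {T' : S → Y} (hT : ∀ l, Measurable (T l)) (hT' : Measurable T')
    (hlim : ∀ s, Tendsto (fun l => T l s) atTop (nhds (T' s))) {K : ℝ≥0∞} (hK : K ≠ ∞)
    (hTρ : ∀ l, σ.map (T l) ≤ K • ρ) (hTρ' : σ.map T' ≤ K • ρ) {w : Y → ℝ} (hw : Measurable w)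
    (hw1 : ∀ y, w y ∈ Set.Icc (0 : ℝ) 1) :
    Tendsto (fun l => ∫ s, |w (T l s) - w (T' s)| ∂σ) atTop (nhds 0) := by
  have habs : ∀ {a b : ℝ}, a ∈ Set.Icc (0 : ℝ) 1 → b ∈ Set.Icc (0 : ℝ) 1 → |a - b| ≤ 1 :=
    fun ha hb => abs_le.2 ⟨by linarith [ha.1, hb.2], by linarith [ha.2, hb.1]⟩
  have bint : ∀ {f : S → ℝ}, Measurable f → (∀ s, |f s| ≤ 1) → Integrable f σ :=
    fun hf h1 => Integrable.of_bound hf.aestronglyMeasurable 1 (ae_of_all _ h1)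
  refine tendsto_order.2 ⟨fun a ha => Eventually.of_forall fun l =>
    ha.trans_le (integral_nonneg fun _ => abs_nonneg _), fun η hη => ?_⟩
  set δ := η / (3 * (K.toReal + 1)) with hδ
  have hK0 : 0 ≤ K.toReal := ENNReal.toReal_nonneg
  obtain ⟨U, hU⟩ := exists_continuous_approx ρ hw hw1 (δ := δ) (by positivity)
  set u : Y → ℝ := fun y => U y with hu
  have huc : Continuous u := continuous_subtype_val.comp U.continuous
  have hu1 : ∀ y, u y ∈ Set.Icc (0 : ℝ) 1 := fun y => (U y).2
  have hdm : Measurable fun y => |w y - u y| := (hw.sub huc.measurable).abs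
  have hKδ : K.toReal * δ ≤ η / 3 := by
    rw [hδ, mul_div_assoc', div_le_div_iff₀ (by positivity) (by positivity)]
    nlinarith
  have key : ∀ {R : S → Y}, Measurable R → σ.map R ≤ K • ρ →
      ∫ s, |w (R s) - u (R s)| ∂σ ≤ η / 3 := fun {R} hR hRρ => by
    rw [← integral_map (f := fun y => |w y - u y|) hR.aemeasurable hdm.aestronglyMeasurable]
    refine (integral_mono_measure hRρ (ae_of_all _ fun _ => abs_nonneg _) ?_).trans ?_
    · refine Integrable.smul_measure ?_ hK
      exact Integrable.of_bound hdm.aestronglyMeasurable 1 (ae_of_all _ fun y => by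
        rw [Real.norm_eq_abs, abs_abs]; exact habs (hw1 y) (hu1 y))
    · rw [integral_smul_measure, smul_eq_mul]
      exact (mul_le_mul_of_nonneg_left hU hK0).trans hKδ
  have hmid : Tendsto (fun l => ∫ s, |u (T l s) - u (T' s)| ∂σ) atTop (nhds 0) := by
    have := tendsto_integral_of_dominated_convergence (μ := σ)
      (F := fun l s => |u (T l s) - u (T' s)|) (f := fun _ => 0) (fun _ => 1)
      (fun l => ((huc.measurable.comp (hT l)).sub (huc.measurable.comp hT')).abs.aestronglyMeasurable)
      (integrable_const _) (fun l => ae_of_all _ fun s => by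
        rw [Real.norm_eq_abs, abs_abs]; exact habs (hu1 _) (hu1 _))
      (ae_of_all _ fun s => by
        have h1 := ((huc.tendsto _).comp (hlim s)).sub_const (u (T' s))
        simpa using h1.abs)
    simpa using this
  filter_upwards [hmid.eventually (gt_mem_nhds (by positivity : 0 < η / 3))] with l hl
  have h1 := key (hT l) (hTρ l)
  have h2 := key hT' hTρ'
  have i1 : Integrable (fun s => |w (T l s) - u (T l s)|) σ :=
    bint (hdm.comp (hT l)) fun s => by rw [abs_abs]; exact habs (hw1 _) (hu1 _)
  have i2 : Integrable (fun s => |w (T' s) - u (T' s)|) σ :=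
    bint (hdm.comp hT') fun s => by rw [abs_abs]; exact habs (hw1 _) (hu1 _)
  have i3 : Integrable (fun s => |u (T l s) - u (T' s)|) σ :=
    bint ((huc.measurable.comp (hT l)).sub (huc.measurable.comp hT')).abs
      fun s => by rw [abs_abs]; exact habs (hu1 _) (hu1 _)
  have h3 : ∫ s, |w (T l s) - w (T' s)| ∂σ ≤ ∫ s, ((|w (T l s) - u (T l s)| +
      |u (T l s) - u (T' s)|) + |w (T' s) - u (T' s)|) ∂σ := by
    refine integral_mono_of_nonneg (ae_of_all _ fun _ => abs_nonneg _) ((i1.add i3).add i2)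
      (ae_of_all _ fun s => ?_)
    have e1 := abs_sub_le (w (T l s)) (u (T l s)) (w (T' s))
    have e2 := abs_sub_le (u (T l s)) (u (T' s)) (w (T' s))
    rw [abs_sub_comm (u (T' s)) (w (T' s))] at e2
    simp only
    linarith
  have h4 := integral_add (i1.add i3) i2
  have h5 := integral_add i1 i3
  simp only [Pi.add_apply] at h4 h5
  linarith

lemma pi_le_smul_pi {ι : Type*} [Fintype ι] {α : Type*} [MeasurableSpace α]
    {ν : ι → Measure α} [∀ i, IsProbabilityMeasure (ν i)] {ρ : Measure α} [IsProbabilityMeasure ρ]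
    {K : ℝ≥0∞} (hK0 : K ≠ 0) (hK : K ≠ ∞) (h : ∀ i, ν i ≤ K • ρ) :
    Measure.pi ν ≤ K ^ Fintype.card ι • Measure.pi fun _ => ρ := by
  set c := K ^ Fintype.card ι with hc
  have hc0 : c ≠ 0 := pow_ne_zero _ hK0
  have hct : c ≠ ∞ := ENNReal.pow_ne_top hK
  have h1 : c⁻¹ • (Measure.pi ν).toOuterMeasure ≤
      OuterMeasure.pi fun _ : ι => ρ.toOuterMeasure := by
    refine OuterMeasure.le_pi.2 fun s _ => ?_
    have : (Measure.pi ν) (Set.pi Set.univ s) ≤ c * ∏ i, ρ (s i) := by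
      rw [Measure.pi_pi, hc, ← Finset.card_univ, ← Finset.prod_const, ← Finset.prod_mul_distrib]
      exact Finset.prod_le_prod' fun i _ => h i (s i)
    change c⁻¹ * (Measure.pi ν) (Set.pi Set.univ s) ≤ ∏ i, ρ (s i)
    calc _ ≤ c⁻¹ * (c * ∏ i, ρ (s i)) := by gcongr
      _ = _ := by rw [← mul_assoc, ENNReal.inv_mul_cancel hc0 hct, one_mul]
  refine Measure.le_iff.2 fun S hS => ?_
  have h2 : c⁻¹ * Measure.pi ν S ≤ (Measure.pi fun _ : ι => ρ) S := by
    rw [Measure.pi_def fun _ : ι => ρ, toMeasure_apply _ _ hS]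
    exact h1 S
  rw [Measure.smul_apply, smul_eq_mul]
  calc Measure.pi ν S = c * (c⁻¹ * Measure.pi ν S) := by
        rw [← mul_assoc, ENNReal.mul_inv_cancel hc0 hct, one_mul]
    _ ≤ _ := by gcongr

/-- Labels up to level `m`. -/
abbrev Cell (m : ℕ) : Type := (Fin m → Bool) × (Fin m → Bool × Bool)

/-- The cell of level `m` that contains a label. -/
def cell (m : ℕ) (p : Label) : Cell m := (fun i => p.1 i, fun i => p.2 i)

lemma continuous_cell (m : ℕ) : Continuous (cell m) := by
  unfold cell
  fun_prop

lemma measurable_cell (m : ℕ) : Measurable (cell m) := by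
  unfold cell
  fun_prop

/-- The smallest position in a cell. -/
def Cell.pos {m : ℕ} (c : Cell m) : ℕ → Bool := fun i => if h : i < m then c.1 ⟨i, h⟩ else false

lemma Cell.pos_cell {m : ℕ} (p : Label) {i : ℕ} (hi : i < m) : (cell m p).pos i = p.1 i := by
  simp [Cell.pos, cell, hi]

/-- The seed whose position starts like those in the cell `c`. -/
def inCell {m : ℕ} (c : Cell m) (q : (ℕ → Bool) × unitInterval) : Seed :=
  (splice (Set.Iio m) c.pos q.1, q.2)

/-- Resample all bits of the position of a seed from bit `m` on. -/
def resample (m : ℕ) (r : (ℕ → Bool) × Seed) : Seed := (splice (Set.Iio m) r.2.1 r.1, r.2.2)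

lemma measurable_inCell {m : ℕ} (c : Cell m) : Measurable (inCell c) := by
  have h : Measurable fun q : (ℕ → Bool) × unitInterval => splice (Set.Iio m) c.pos q.1 :=
    (measurable_splice _).comp (measurable_const.prodMk measurable_fst)
  exact h.prodMk measurable_snd

lemma measurable_resample (m : ℕ) : Measurable (resample m) := by
  have h : Measurable fun r : (ℕ → Bool) × Seed => splice (Set.Iio m) r.2.1 r.1 :=
    (measurable_splice _).comp (measurable_snd.fst.prodMk measurable_fst)
  exact h.prodMk measurable_snd.snd

lemma resample_eq_inCell {m : ℕ} {g : Seed → Label} (hg : ∀ ω, (g ω).1 = ω.1)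
    (r : (ℕ → Bool) × Seed) : resample m r = inCell (cell m (g r.2)) (r.1, r.2.2) := by
  refine Prod.ext (funext fun i => ?_) rfl
  simp only [resample, inCell, splice, Set.mem_Iio]
  split_ifs with h
  · rw [Cell.pos_cell _ h, hg]
  · rfl

lemma exists_cell_law {C : Type*} [Fintype C] [MeasurableSpace C] [MeasurableSingletonClass C]
    (κ : Seed → C) :
    ∃ Q : C → Measure unitInterval, (∀ c, IsProbabilityMeasure (Q c)) ∧
      (∀ c, seedMeasure (κ ⁻¹' {c}) • Q c = (seedMeasure.restrict (κ ⁻¹' {c})).map Prod.snd) ∧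
      ∃ K : ℝ≥0∞, K ≠ 0 ∧ K ≠ ∞ ∧ ∀ c, Q c ≤ K • volume := by
  have hsnd : seedMeasure.map Prod.snd = (volume : Measure unitInterval) := by
    rw [seedMeasure, Measure.map_snd_prod]
    simp
  have key : ∀ c, ∃ Q : Measure unitInterval, IsProbabilityMeasure Q ∧
      seedMeasure (κ ⁻¹' {c}) • Q = (seedMeasure.restrict (κ ⁻¹' {c})).map Prod.snd ∧
      ∃ K : ℝ≥0∞, K ≠ ∞ ∧ Q ≤ K • volume := fun c => by
    set A := κ ⁻¹' {c} with hA
    by_cases h0 : seedMeasure A = 0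
    · refine ⟨volume, inferInstance, ?_, 1, ENNReal.one_ne_top, by simp⟩
      rw [h0, Measure.restrict_eq_zero.2 h0]
      simp
    · have hinv : seedMeasure A * (seedMeasure A)⁻¹ = 1 :=
        ENNReal.mul_inv_cancel h0 (measure_ne_top _ _)
      refine ⟨(seedMeasure A)⁻¹ • (seedMeasure.restrict A).map Prod.snd, ⟨?_⟩, ?_,
        (seedMeasure A)⁻¹, ENNReal.inv_ne_top.2 h0, ?_⟩
      · rw [Measure.smul_apply, Measure.map_apply measurable_snd MeasurableSet.univ]
        simpa [mul_comm] using hinv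
      · rw [smul_smul, hinv, one_smul]
      · refine Measure.le_iff.2 fun S hS => ?_
        rw [Measure.smul_apply, Measure.smul_apply, ← hsnd]
        exact mul_le_mul_right (Measure.map_mono Measure.restrict_le_self measurable_snd S) _
  choose Q hQ1 hQ2 K hK hQK using key
  refine ⟨Q, hQ1, hQ2, 1 + ∑ c, K c, by simp, by simp [ENNReal.sum_eq_top, hK], fun c => ?_⟩
  refine (hQK c).trans (Measure.le_iff.2 fun S _ => ?_)
  rw [Measure.smul_apply, Measure.smul_apply]
  refine mul_le_mul_left ((Finset.single_le_sum (f := K) (fun _ _ => zero_le)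
    (Finset.mem_univ c)).trans le_add_self) _

lemma integral_prod_eq_sum_cells {S C : Type*} [MeasurableSpace S] [Fintype C] [MeasurableSpace C]
    [MeasurableSingletonClass C] {σ : Measure S} [IsProbabilityMeasure σ] {κ : S → C}
    (hκ : Measurable κ) {h : S × S → ℝ} (hh : Integrable h (σ.prod σ)) :
    ∫ q, h q ∂(σ.prod σ) = ∑ c : C × C, ∫ q, h q
      ∂((σ.restrict (κ ⁻¹' {c.1})).prod (σ.restrict (κ ⁻¹' {c.2}))) := by
  simp only [Measure.prod_restrict]
  have hm : ∀ c : C × C, MeasurableSet ((κ ⁻¹' {c.1}) ×ˢ (κ ⁻¹' {c.2})) := fun c =>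
    (hκ (MeasurableSet.singleton _)).prod (hκ (MeasurableSet.singleton _))
  have hU : ⋃ c : C × C, ((κ ⁻¹' {c.1}) ×ˢ (κ ⁻¹' {c.2})) = (Set.univ : Set (S × S)) := by
    ext q
    simp
  rw [← integral_iUnion_fintype hm ?_ fun c => hh.integrableOn, hU, Measure.restrict_univ]
  intro c d hcd
  refine Set.disjoint_left.2 fun q hc hd => hcd ?_
  simp only [Set.mem_prod, Set.mem_preimage, Set.mem_singleton_iff] at hc hd
  exact Prod.ext (hc.1.symm.trans hd.1) (hc.2.symm.trans hd.2)

/-- Indicator of the event that an edge (if `b`) or non-edge (if not `b`) has probability zero. -/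
def zeroInd (b : Prop) (z : ℝ) : ℝ := if edgeWeight b z = 0 then 1 else 0

lemma zeroInd_mem (b : Prop) (z : ℝ) : zeroInd b z ∈ Set.Icc (0 : ℝ) 1 := by
  unfold zeroInd; split_ifs <;> simp

lemma measurable_zeroInd (b : Prop) : Measurable (zeroInd b) :=
  Measurable.ite ((continuous_edgeWeight b).measurable (MeasurableSet.singleton 0))
    measurable_const measurable_const

lemma edgeWeight_mul_zeroInd_le (b : Prop) {z z' : ℝ} :
    edgeWeight b z * zeroInd b z' ≤ |z - z'| := by
  unfold zeroInd
  split_ifs with h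
  · rw [← abs_edgeWeight_sub b, h, mul_one, sub_zero]
    exact le_abs_self _
  · rw [mul_zero]
    exact abs_nonneg _

/-- The expectation of `w` at independent random seeds of two given cells. -/
def cellMean {m : ℕ} (Q : Cell m → Measure unitInterval) (w : Seed × Seed → ℝ) (c c' : Cell m) : ℝ :=
  ∫ q, w (inCell c q.1, inCell c' q.2) ∂((coin.prod (Q c)).prod (coin.prod (Q c')))

lemma cellMean_mem {m : ℕ} {Q : Cell m → Measure unitInterval} [∀ c, IsProbabilityMeasure (Q c)]
    {w : Seed × Seed → ℝ} (hw1 : ∀ p, w p ∈ Set.Icc (0 : ℝ) 1) (c c' : Cell m) :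
    cellMean Q w c c' ∈ Set.Icc (0 : ℝ) 1 := by
  refine ⟨integral_nonneg fun _ => (hw1 _).1, ?_⟩
  refine (integral_mono_of_nonneg (ae_of_all _ fun _ => (hw1 _).1) (integrable_const 1)
    (ae_of_all _ fun _ => (hw1 _).2)).trans ?_
  simp

lemma integral_mul_cellMean {m : ℕ} {g : Seed → Label} (hgm : Measurable g)
    (hg : ∀ ω, (g ω).1 = ω.1) {Q : Cell m → Measure unitInterval}
    [∀ c, IsProbabilityMeasure (Q c)]
    (hQ : ∀ c, seedMeasure ((fun ω => cell m (g ω)) ⁻¹' {c}) • Q c =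
      (seedMeasure.restrict ((fun ω => cell m (g ω)) ⁻¹' {c})).map Prod.snd)
    {w : Seed × Seed → ℝ} (hw : Measurable w) (hw1 : ∀ p, w p ∈ Set.Icc (0 : ℝ) 1)
    {u : Cell m → Cell m → ℝ} (hu : ∀ c c', u c c' ∈ Set.Icc (0 : ℝ) 1) :
    ∫ p, u (cell m (g p.1)) (cell m (g p.2)) *
        cellMean Q w (cell m (g p.1)) (cell m (g p.2)) ∂(seedMeasure.prod seedMeasure) =
      ∫ r, u (cell m (g r.1.2)) (cell m (g r.2.2)) * w (resample m r.1, resample m r.2)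
        ∂((coin.prod seedMeasure).prod (coin.prod seedMeasure)) := by
  set κ : Seed → Cell m := fun ω => cell m (g ω) with hκ
  have hκm : Measurable κ := (measurable_cell m).comp hgm
  have hκ2 : Measurable fun r : (ℕ → Bool) × Seed => κ r.2 := hκm.comp measurable_snd
  have hum : Measurable fun q : Cell m × Cell m => u q.1 q.2 := measurable_of_finite _
  have hcm : Measurable fun q : Cell m × Cell m => cellMean Q w q.1 q.2 := measurable_of_finite _
  have hrm := measurable_resample m
  have h01 : ∀ {a b : ℝ}, a ∈ Set.Icc (0 : ℝ) 1 → b ∈ Set.Icc (0 : ℝ) 1 → ‖a * b‖ ≤ 1 :=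
    fun ha hb => by
      rw [Real.norm_eq_abs, abs_of_nonneg (mul_nonneg ha.1 hb.1)]
      exact mul_le_one₀ ha.2 hb.1 hb.2
  have hI1 : Integrable (fun p : Seed × Seed => u (κ p.1) (κ p.2) * cellMean Q w (κ p.1) (κ p.2))
      (seedMeasure.prod seedMeasure) := by
    have hκκ : Measurable fun p : Seed × Seed => (κ p.1, κ p.2) := hκm.prodMap hκm
    exact Integrable.of_bound ((hum.comp hκκ).mul (hcm.comp hκκ)).aestronglyMeasurable 1
      (ae_of_all _ fun p => h01 (hu _ _) (cellMean_mem hw1 _ _))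
  have hI2 : Integrable (fun r : ((ℕ → Bool) × Seed) × ((ℕ → Bool) × Seed) =>
      u (κ r.1.2) (κ r.2.2) * w (resample m r.1, resample m r.2))
      ((coin.prod seedMeasure).prod (coin.prod seedMeasure)) := by
    have hκκ : Measurable fun r : ((ℕ → Bool) × Seed) × ((ℕ → Bool) × Seed) =>
      (κ r.1.2, κ r.2.2) := hκ2.prodMap hκ2
    have hrr : Measurable fun r : ((ℕ → Bool) × Seed) × ((ℕ → Bool) × Seed) =>
      (resample m r.1, resample m r.2) := hrm.prodMap hrm
    exact Integrable.of_bound ((hum.comp hκκ).mul (hw.comp hrr)).aestronglyMeasurable 1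
      (ae_of_all _ fun p => h01 (hu _ _) (hw1 _))
  refine (integral_prod_eq_sum_cells hκm hI1).trans
    (Eq.trans ?_ (integral_prod_eq_sum_cells hκ2 hI2).symm)
  refine Finset.sum_congr rfl fun c _ => ?_
  obtain ⟨c, d⟩ := c
  have hset : ∀ c, (fun r : (ℕ → Bool) × Seed => κ r.2) ⁻¹' {c} = Set.univ ×ˢ (κ ⁻¹' {c}) := by
    intro c; ext r; simp
  have hrestr : ∀ c, (coin.prod seedMeasure).restrict
      ((fun r : (ℕ → Bool) × Seed => κ r.2) ⁻¹' {c}) =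
      coin.prod (seedMeasure.restrict (κ ⁻¹' {c})) := fun c => by
    rw [hset, ← Measure.prod_restrict, Measure.restrict_univ]
  have hmA : ∀ c, MeasurableSet (κ ⁻¹' {c}) := fun c => hκm (MeasurableSet.singleton c)
  have hlaw : ∀ c, (coin.prod (seedMeasure.restrict (κ ⁻¹' {c}))).map (Prod.map id Prod.snd) =
      seedMeasure (κ ⁻¹' {c}) • coin.prod (Q c) := fun c => by
    rw [← Measure.map_prod_map _ _ measurable_id measurable_snd, ← hQ c, Measure.map_id]
    exact Measure.prod_smul_right _
  have hm2 : Measurable (Prod.map id Prod.snd : (ℕ → Bool) × Seed → (ℕ → Bool) × unitInterval) :=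
    measurable_id.prodMap measurable_snd
  simp only [hrestr]
  have hae : ∀ c, ∀ᵐ ω ∂(seedMeasure.restrict (κ ⁻¹' {c})), κ ω = c := fun c =>
    ae_restrict_mem (hmA c)
  have e1 : ∫ q, u (κ q.1) (κ q.2) * cellMean Q w (κ q.1) (κ q.2)
      ∂((seedMeasure.restrict (κ ⁻¹' {c})).prod (seedMeasure.restrict (κ ⁻¹' {d}))) =
      (seedMeasure.real (κ ⁻¹' {c}) * seedMeasure.real (κ ⁻¹' {d})) *
        (u c d * cellMean Q w c d) := by
    have : (fun q : Seed × Seed => u (κ q.1) (κ q.2) * cellMean Q w (κ q.1) (κ q.2))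
        =ᵐ[(seedMeasure.restrict (κ ⁻¹' {c})).prod (seedMeasure.restrict (κ ⁻¹' {d}))]
        fun _ => u c d * cellMean Q w c d := by
      filter_upwards [Measure.quasiMeasurePreserving_fst.ae (hae c),
        Measure.quasiMeasurePreserving_snd.ae (hae d)] with q h1 h2
      rw [h1, h2]
    rw [integral_congr_ae this, integral_const, measureReal_def, ← Set.univ_prod_univ,
      Measure.prod_prod, Measure.restrict_apply_univ, Measure.restrict_apply_univ,
      ENNReal.toReal_mul, smul_eq_mul]
    rfl
  have e2 : ∫ r, u (κ r.1.2) (κ r.2.2) * w (resample m r.1, resample m r.2)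
      ∂((coin.prod (seedMeasure.restrict (κ ⁻¹' {c}))).prod
        (coin.prod (seedMeasure.restrict (κ ⁻¹' {d})))) =
      (seedMeasure.real (κ ⁻¹' {c}) * seedMeasure.real (κ ⁻¹' {d})) *
        (u c d * cellMean Q w c d) := by
    have : (fun r : ((ℕ → Bool) × Seed) × ((ℕ → Bool) × Seed) =>
          u (κ r.1.2) (κ r.2.2) * w (resample m r.1, resample m r.2))
        =ᵐ[(coin.prod (seedMeasure.restrict (κ ⁻¹' {c}))).prod
          (coin.prod (seedMeasure.restrict (κ ⁻¹' {d})))]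
        fun r => u c d * w (inCell c (Prod.map id Prod.snd r.1),
          inCell d (Prod.map id Prod.snd r.2)) := by
      filter_upwards [Measure.quasiMeasurePreserving_fst.ae
          (Measure.quasiMeasurePreserving_snd.ae (hae c)),
        Measure.quasiMeasurePreserving_snd.ae
          (Measure.quasiMeasurePreserving_snd.ae (hae d))] with q h1 h2
      rw [resample_eq_inCell hg, resample_eq_inCell hg]
      simp only [hκ] at h1 h2
      simp only [hκ, h1, h2]
      rfl
    have hic : Measurable fun q : ((ℕ → Bool) × unitInterval) × ((ℕ → Bool) × unitInterval) =>
        w (inCell c q.1, inCell d q.2) :=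
      hw.comp ((measurable_inCell c).prodMap (measurable_inCell d))
    rw [integral_congr_ae this, integral_const_mul]
    have hmap := Measure.map_prod_map (coin.prod (seedMeasure.restrict (κ ⁻¹' {c})))
      (coin.prod (seedMeasure.restrict (κ ⁻¹' {d}))) hm2 hm2
    rw [hlaw, hlaw] at hmap
    have h3 := integral_map (hm2.prodMap hm2).aemeasurable
      (μ := (coin.prod (seedMeasure.restrict (κ ⁻¹' {c}))).prod
        (coin.prod (seedMeasure.restrict (κ ⁻¹' {d}))))
      (f := fun q => w (inCell c q.1, inCell d q.2)) hic.aestronglyMeasurable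
    rw [← hmap, Measure.prod_smul_left, Measure.prod_smul_right, smul_smul,
      integral_smul_measure] at h3
    simp only [Prod.map_fst, Prod.map_snd] at h3
    rw [← h3, cellMean, ENNReal.toReal_mul, smul_eq_mul]
    simp only [measureReal_def]
    ring
  exact e1.trans e2.symm

/-- A label in a given cell. -/
def Cell.label {m : ℕ} (c : Cell m) : Label :=
  (c.pos, fun i => if h : i < m then c.2 ⟨i, h⟩ else default)

lemma tendsto_label_cell (p : Label) :
    Tendsto (fun m => (cell m p).label) atTop (nhds p) := by
  have h1 : Tendsto (fun m => (cell m p).pos) atTop (nhds p.1) := by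
    refine tendsto_pi_nhds.2 fun i => tendsto_const_nhds.congr' ?_
    filter_upwards [eventually_gt_atTop i] with m hm
    exact (Cell.pos_cell p hm).symm
  have h2 : Tendsto (fun m => (cell m p).label.2) atTop (nhds p.2) := by
    refine tendsto_pi_nhds.2 fun i => tendsto_const_nhds.congr' ?_
    filter_upwards [eventually_gt_atTop i] with m hm
    simp [Cell.label, cell, hm]
  exact h1.prodMk_nhds h2

lemma tendsto_resample (r : (ℕ → Bool) × Seed) :
    Tendsto (fun m => resample m r) atTop (nhds r.2) := by
  have h1 : Tendsto (fun m => splice (Set.Iio m) r.2.1 r.1) atTop (nhds r.2.1) := by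
    refine tendsto_pi_nhds.2 fun i => tendsto_const_nhds.congr' ?_
    filter_upwards [eventually_gt_atTop i] with m hm
    simp [splice, hm]
  exact h1.prodMk_nhds tendsto_const_nhds

lemma map_resample (m : ℕ) : (coin.prod seedMeasure).map (resample m) = seedMeasure := by
  have h1 : (coin.prod (coin.prod (volume : Measure unitInterval))).map
      (fun r => ((r.2.1, r.1), r.2.2)) = (coin.prod coin).prod volume := by
    exact ((Measure.measurePreserving_swap.prod (MeasurePreserving.id volume)).comp
      ((measurePreserving_prodAssoc coin coin (volume : Measure unitInterval)).symm _)).map_eq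
  have h2 : resample m = Prod.map (fun q : (ℕ → Bool) × (ℕ → Bool) => splice (Set.Iio m) q.1 q.2)
      (id : unitInterval → unitInterval) ∘ fun r => ((r.2.1, r.1), r.2.2) := rfl
  rw [h2, ← Measure.map_map ((measurable_splice _).prodMap measurable_id) (by fun_prop), seedMeasure,
    h1, ← Measure.map_prod_map _ _ (measurable_splice _) measurable_id, map_splice_coin,
    Measure.map_id]

lemma abs_sub_le_one_of_mem {a b : ℝ} (ha : a ∈ Set.Icc (0 : ℝ) 1) (hb : b ∈ Set.Icc (0 : ℝ) 1) :
    |a - b| ≤ 1 :=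
  abs_le.2 ⟨by linarith [ha.1, hb.2], by linarith [ha.2, hb.1]⟩

lemma exists_cell_approx (μ : Measure Label) [IsProbabilityMeasure μ] {W : Label × Label → ℝ}
    (hW : Measurable W) (hW1 : ∀ p, W p ∈ Set.Icc (0 : ℝ) 1) {η : ℝ} (hη : 0 < η) :
    ∀ᶠ m in atTop, ∃ u : Cell m → Cell m → ℝ, (∀ c c', u c c' ∈ Set.Icc (0 : ℝ) 1) ∧
      ∫ p, |W p - u (cell m p.1) (cell m p.2)| ∂(μ.prod μ) ≤ η := by
  obtain ⟨U, hU⟩ := exists_continuous_approx (μ.prod μ) hW hW1 (half_pos hη)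
  set V : Label × Label → ℝ := fun p => U p with hV
  have hVc : Continuous V := continuous_subtype_val.comp U.continuous
  have hV1 : ∀ p, V p ∈ Set.Icc (0 : ℝ) 1 := fun p => (U p).2
  set u : ∀ m, Cell m → Cell m → ℝ := fun m c c' => V (c.label, c'.label) with hu
  have hum : ∀ m, Measurable fun p : Label × Label => u m (cell m p.1) (cell m p.2) := fun m => by
    have h1 : Measurable fun q : Cell m × Cell m => u m q.1 q.2 := measurable_of_finite _
    exact h1.comp ((measurable_cell m).prodMap (measurable_cell m))
  have hlim : Tendsto (fun m => ∫ p, |V p - u m (cell m p.1) (cell m p.2)| ∂(μ.prod μ)) atTop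
      (nhds 0) := by
    have := tendsto_integral_of_dominated_convergence (μ := μ.prod μ)
      (F := fun m p => |V p - u m (cell m p.1) (cell m p.2)|) (f := fun _ => 0) (fun _ => 1)
      (fun m => (hVc.measurable.sub (hum m)).abs.aestronglyMeasurable)
      (integrable_const _) (fun m => ae_of_all _ fun p => by
        rw [Real.norm_eq_abs, abs_abs]; exact abs_sub_le_one_of_mem (hV1 _) (hV1 _))
      (ae_of_all _ fun p => by
        have h1 : Tendsto (fun m => u m (cell m p.1) (cell m p.2)) atTop (nhds (V p)) :=
          (hVc.tendsto p).comp ((tendsto_label_cell p.1).prodMk_nhds (tendsto_label_cell p.2))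
        simpa using (h1.const_sub (V p)).abs)
    simpa using this
  filter_upwards [hlim.eventually (gt_mem_nhds (half_pos hη))] with m hm
  refine ⟨u m, fun c c' => hV1 _, ?_⟩
  have i1 : Integrable (fun p => |W p - V p|) (μ.prod μ) :=
    Integrable.of_bound (hW.sub hVc.measurable).abs.aestronglyMeasurable 1 (ae_of_all _ fun p => by
      rw [Real.norm_eq_abs, abs_abs]; exact abs_sub_le_one_of_mem (hW1 _) (hV1 _))
  have i2 : Integrable (fun p => |V p - u m (cell m p.1) (cell m p.2)|) (μ.prod μ) :=
    Integrable.of_bound (hVc.measurable.sub (hum m)).abs.aestronglyMeasurable 1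
      (ae_of_all _ fun p => by
        rw [Real.norm_eq_abs, abs_abs]; exact abs_sub_le_one_of_mem (hV1 _) (hV1 _))
  refine (integral_mono_of_nonneg (ae_of_all _ fun _ => abs_nonneg _) (i1.add i2)
    (ae_of_all _ fun p => abs_sub_le _ (V p) _)).trans ?_
  rw [integral_add' i1 i2]
  linarith

lemma exists_zero_bound {μ : Measure Label} [IsProbabilityMeasure μ] {W : Label × Label → ℝ}
    (hW : Measurable W) (hW1 : ∀ p, W p ∈ Set.Icc (0 : ℝ) 1) {g : Seed → Label}
    (hgm : Measurable g) (hg : ∀ ω, (g ω).1 = ω.1) (hgμ : seedMeasure.map g = μ)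
    {η : ℝ} (hη : 0 < η) :
    ∀ᶠ m in atTop, ∀ Q : Cell m → Measure unitInterval, (∀ c, IsProbabilityMeasure (Q c)) →
      (∀ c, seedMeasure ((fun ω => cell m (g ω)) ⁻¹' {c}) • Q c =
        (seedMeasure.restrict ((fun ω => cell m (g ω)) ⁻¹' {c})).map Prod.snd) →
      ∀ b : Prop, ∫ p, edgeWeight b (W p) *
        cellMean Q (fun q => zeroInd b (W (g q.1, g q.2))) (cell m p.1) (cell m p.2) ∂(μ.prod μ)
        ≤ 3 * η := by
  set w : Seed × Seed → ℝ := fun q => W (g q.1, g q.2) with hwdef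
  have hgg : Measurable fun q : Seed × Seed => (g q.1, g q.2) := hgm.prodMap hgm
  have hw : Measurable w := hW.comp hgg
  have hw1 : ∀ q, w q ∈ Set.Icc (0 : ℝ) 1 := fun q => hW1 _
  have hrr : ∀ m, Measurable fun r : ((ℕ → Bool) × Seed) × ((ℕ → Bool) × Seed) =>
      (resample m r.1, resample m r.2) := fun m =>
    (measurable_resample m).prodMap (measurable_resample m)
  set ρ := (coin.prod seedMeasure).prod (coin.prod seedMeasure) with hρ
  have hmap1 : ∀ m, ρ.map (fun r => (resample m r.1, resample m r.2)) =
      seedMeasure.prod seedMeasure := fun m => by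
    have := Measure.map_prod_map (coin.prod seedMeasure) (coin.prod seedMeasure)
      (measurable_resample m) (measurable_resample m)
    rw [map_resample] at this
    exact this.symm
  have hmap2 : ρ.map (fun r => (r.1.2, r.2.2)) = seedMeasure.prod seedMeasure := by
    have := Measure.map_prod_map (coin.prod seedMeasure) (coin.prod seedMeasure)
      measurable_snd measurable_snd
    rw [Measure.map_snd_prod] at this
    simp only [measure_univ, one_smul] at this
    exact this.symm
  have hmap3 : (seedMeasure.prod seedMeasure).map (fun q => (g q.1, g q.2)) = μ.prod μ := by
    have := Measure.map_prod_map seedMeasure seedMeasure hgm hgm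
    rw [hgμ] at this
    exact this.symm
  have hres : Tendsto (fun m => ∫ r, |w (resample m r.1, resample m r.2) - w (r.1.2, r.2.2)| ∂ρ)
      atTop (nhds 0) :=
    tendsto_integral_abs_comp_sub (ρ := seedMeasure.prod seedMeasure) (σ := ρ)
      (T := fun m r => (resample m r.1, resample m r.2)) (T' := fun r => (r.1.2, r.2.2)) hrr
      (by fun_prop) (fun r => (tendsto_resample r.1).prodMk_nhds (tendsto_resample r.2))
      ENNReal.one_ne_top (fun m => by rw [hmap1, one_smul]) (by rw [hmap2, one_smul]) hw hw1
  filter_upwards [exists_cell_approx μ hW hW1 hη, hres.eventually (gt_mem_nhds hη)]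
    with m ⟨u, hu1, hu⟩ hm Q hQ1 hQ b
  set v : Label × Label → ℝ := fun p => u (cell m p.1) (cell m p.2) with hvdef
  have hv1 : ∀ p, v p ∈ Set.Icc (0 : ℝ) 1 := fun p => hu1 _ _
  have hcc : Measurable fun p : Label × Label => (cell m p.1, cell m p.2) :=
    (measurable_cell m).prodMap (measurable_cell m)
  have hum : Measurable fun q : Cell m × Cell m => u q.1 q.2 := measurable_of_finite _
  have hv : Measurable v := hum.comp hcc
  set w₀ : Seed × Seed → ℝ := fun q => zeroInd b (w q) with hw₀
  have hw₀m : Measurable w₀ := (measurable_zeroInd b).comp hw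
  have hw₀1 : ∀ q, w₀ q ∈ Set.Icc (0 : ℝ) 1 := fun q => zeroInd_mem b _
  set Φ : Label × Label → ℝ := fun p => cellMean Q w₀ (cell m p.1) (cell m p.2) with hΦ
  have hΦ1 : ∀ p, Φ p ∈ Set.Icc (0 : ℝ) 1 := fun p => cellMean_mem hw₀1 _ _
  have hΦm : Measurable Φ := by
    have h1 : Measurable fun q : Cell m × Cell m => cellMean Q w₀ q.1 q.2 := measurable_of_finite _
    exact h1.comp hcc
  have hEm := (continuous_edgeWeight b).measurable
  have i1 : Integrable (fun p => |W p - v p|) (μ.prod μ) :=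
    Integrable.of_bound (hW.sub hv).abs.aestronglyMeasurable 1 (ae_of_all _ fun p => by
      rw [Real.norm_eq_abs, abs_abs]; exact abs_sub_le_one_of_mem (hW1 _) (hv1 _))
  have i2 : Integrable (fun p => edgeWeight b (v p) * Φ p) (μ.prod μ) :=
    Integrable.of_bound ((hEm.comp hv).mul hΦm).aestronglyMeasurable 1 (ae_of_all _ fun p => by
      have h1 := edgeWeight_mem b (hv1 p)
      rw [Real.norm_eq_abs, abs_of_nonneg (mul_nonneg h1.1 (hΦ1 p).1)]
      exact mul_le_one₀ h1.2 (hΦ1 p).1 (hΦ1 p).2)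
  have s1 : ∫ p, edgeWeight b (W p) * Φ p ∂(μ.prod μ) ≤
      η + ∫ p, edgeWeight b (v p) * Φ p ∂(μ.prod μ) := by
    have h1 : ∫ p, edgeWeight b (W p) * Φ p ∂(μ.prod μ) ≤
        ∫ p, (|W p - v p| + edgeWeight b (v p) * Φ p) ∂(μ.prod μ) := by
      refine integral_mono_of_nonneg (ae_of_all _ fun p =>
        mul_nonneg (edgeWeight_mem b (hW1 p)).1 (hΦ1 p).1) (i1.add i2) (ae_of_all _ fun p => ?_)
      have h2 : edgeWeight b (W p) - edgeWeight b (v p) ≤ |W p - v p| := by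
        rw [← abs_edgeWeight_sub b]; exact le_abs_self _
      have h3 : (edgeWeight b (W p) - edgeWeight b (v p)) * Φ p ≤ |W p - v p| :=
        (mul_le_mul_of_nonneg_right h2 (hΦ1 p).1).trans
          (mul_le_of_le_one_right (abs_nonneg _) (hΦ1 p).2)
      simp only
      linarith
    rw [integral_add i1 i2] at h1
    linarith
  have s2 : ∫ p, edgeWeight b (v p) * Φ p ∂(μ.prod μ) =
      ∫ r, edgeWeight b (v (g r.1.2, g r.2.2)) * w₀ (resample m r.1, resample m r.2) ∂ρ := by
    rw [← hmap3, integral_map (f := fun p => edgeWeight b (v p) * Φ p) hgg.aemeasurable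
      ((hEm.comp hv).mul hΦm).aestronglyMeasurable]
    exact integral_mul_cellMean hgm hg hQ hw₀m hw₀1
      (u := fun c c' => edgeWeight b (u c c')) fun c c' => edgeWeight_mem b (hu1 c c')
  have hr2 : Measurable fun r : ((ℕ → Bool) × Seed) × ((ℕ → Bool) × Seed) => (r.1.2, r.2.2) := by
    fun_prop
  have i3 : Integrable (fun r : ((ℕ → Bool) × Seed) × ((ℕ → Bool) × Seed) =>
      |w (r.1.2, r.2.2) - v (g r.1.2, g r.2.2)|) ρ :=
    Integrable.of_bound ((hw.comp hr2).sub (hv.comp (hgg.comp hr2))).abs.aestronglyMeasurable 1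
      (ae_of_all _ fun p => by
        rw [Real.norm_eq_abs, abs_abs]; exact abs_sub_le_one_of_mem (hw1 _) (hv1 _))
  have i4 : Integrable (fun r : ((ℕ → Bool) × Seed) × ((ℕ → Bool) × Seed) =>
      |w (resample m r.1, resample m r.2) - w (r.1.2, r.2.2)|) ρ :=
    Integrable.of_bound ((hw.comp (hrr m)).sub (hw.comp hr2)).abs.aestronglyMeasurable 1
      (ae_of_all _ fun p => by
        rw [Real.norm_eq_abs, abs_abs]; exact abs_sub_le_one_of_mem (hw1 _) (hw1 _))
  have s3 : ∫ r, edgeWeight b (v (g r.1.2, g r.2.2)) * w₀ (resample m r.1, resample m r.2) ∂ρ ≤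
      ∫ r, (|w (r.1.2, r.2.2) - v (g r.1.2, g r.2.2)| +
        |w (resample m r.1, resample m r.2) - w (r.1.2, r.2.2)|) ∂ρ := by
    refine integral_mono_of_nonneg (ae_of_all _ fun r =>
      mul_nonneg (edgeWeight_mem b (hv1 _)).1 (hw₀1 _).1) (i3.add i4) (ae_of_all _ fun r => ?_)
    refine (edgeWeight_mul_zeroInd_le b).trans ((abs_sub_le _ (w (r.1.2, r.2.2)) _).trans ?_)
    rw [abs_sub_comm (v _), abs_sub_comm (w (r.1.2, r.2.2)) (w (resample m r.1, _))]
  have s4 : ∫ r, |w (r.1.2, r.2.2) - v (g r.1.2, g r.2.2)| ∂ρ = ∫ p, |W p - v p| ∂(μ.prod μ) := by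
    rw [← hmap3, integral_map (f := fun p => |W p - v p|) hgg.aemeasurable
      (hW.sub hv).abs.aestronglyMeasurable, ← hmap2,
      integral_map (f := fun q => |W (g q.1, g q.2) - v (g q.1, g q.2)|) hr2.aemeasurable
        ((hw.sub (hv.comp hgg)).abs.aestronglyMeasurable)]
  rw [integral_add i3 i4] at s3
  linarith

lemma map_prod_prod_comm {A B C D : Type*} [MeasurableSpace A] [MeasurableSpace B]
    [MeasurableSpace C] [MeasurableSpace D] (α : Measure A) (β : Measure B) (γ : Measure C)
    (δ : Measure D) [SFinite α] [SFinite β] [SFinite γ] [SFinite δ] :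
    ((α.prod β).prod (γ.prod δ)).map (fun r => ((r.1.1, r.2.1), (r.1.2, r.2.2))) =
      (α.prod γ).prod (β.prod δ) := by
  have h1 := measurePreserving_prodAssoc α β (γ.prod δ)
  have h2 := (MeasurePreserving.id α).prod
    ((measurePreserving_prodAssoc β γ δ).symm MeasurableEquiv.prodAssoc)
  have h3 := (MeasurePreserving.id α).prod
    ((Measure.measurePreserving_swap (μ := β) (ν := γ)).prod (MeasurePreserving.id δ))
  have h4 := (MeasurePreserving.id α).prod (measurePreserving_prodAssoc γ β δ)
  have h5 := (measurePreserving_prodAssoc α γ (β.prod δ)).symm MeasurableEquiv.prodAssoc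
  exact (h5.comp (h4.comp (h3.comp (h2.comp h1)))).map_eq

lemma map_overwrite_seed_le {q : Measure unitInterval} [IsProbabilityMeasure q] {K : ℝ≥0∞}
    (hq : q ≤ K • volume) (B : Finset ℕ) (c : ℕ → Bool) :
    (coin.prod q).map (fun s => (splice B c s.1, s.2)) ≤ ((2 : ℝ≥0∞) ^ B.card * K) • seedMeasure := by
  have hm : Measurable fun z => splice B c z :=
    (measurable_splice B).comp (measurable_const.prodMk measurable_id)
  have h1 := Measure.map_prod_map coin q hm measurable_id
  have h2 : (coin.prod q).map (fun s => (splice B c s.1, s.2)) =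
      (coin.map fun z => splice B c z).prod q := by
    rw [Measure.map_id] at h1
    exact h1.symm
  rw [h2]
  refine (Measure.prod_mono (map_overwrite_coin_le B c) hq).trans (le_of_eq ?_)
  rw [Measure.prod_smul_left, Measure.prod_smul_right, smul_smul, seedMeasure]

/-- The first bits of the position of a sampled vertex: those of the cell `c`, then those of `z`
up to bit `ℓ`, then a unary code of `j`. -/
def template {m : ℕ} (ℓ : ℕ) (c : Cell m) (j : ℕ) (z : ℕ → Bool) : ℕ → Bool :=
  fun i => if i < m then c.pos i else if i < ℓ then z i else decide (i < ℓ + j)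

/-- The seed of a sampled vertex. -/
def place {m : ℕ} (N l : ℕ) (c : Cell m) (j : ℕ) (z : ℕ → Bool) (s : Seed) : Seed :=
  (splice (Finset.range (m + l + N)) (template (m + l) c j z) s.1, s.2)

lemma place_eq_overwrite {m : ℕ} (N l : ℕ) (c : Cell m) (j : ℕ) (z : ℕ → Bool) (s : Seed) :
    place N l c j z s = (splice (Finset.range m ∪ Finset.Ico (m + l) (m + l + N) : Finset ℕ)
      (template (m + l) c j z) (splice (Set.Iio (m + l)) z s.1), s.2) := by
  refine Prod.ext (funext fun i => ?_) rfl
  simp only [place, splice, Finset.mem_coe, Finset.mem_range, Finset.mem_union, Finset.mem_Ico,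
    Set.mem_Iio, template]
  split_ifs <;> first | rfl | omega

lemma template_eq_of {m : ℕ} (N l : ℕ) (c : Cell m) (j : ℕ) (z z' : ℕ → Bool) (x : ℕ → Bool) :
    splice (Finset.range m ∪ Finset.Ico (m + l) (m + l + N) : Finset ℕ)
      (template (m + l) c j z) x = splice (Finset.range m ∪ Finset.Ico (m + l) (m + l + N) : Finset ℕ)
      (template (m + l) c j z') x := by
  refine funext fun i => ?_
  simp only [splice, Finset.mem_coe, Finset.mem_range, Finset.mem_union, Finset.mem_Ico, template]
  split_ifs <;> first | rfl | omega

lemma measurable_place {m : ℕ} (N l : ℕ) (c : Cell m) (j : ℕ) :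
    Measurable fun r : (ℕ → Bool) × Seed => place N l c j r.1 r.2 := by
  have h1 : Measurable fun r : (ℕ → Bool) × Seed => template (m + l) c j r.1 := by
    refine measurable_pi_iff.2 fun i => ?_
    unfold template
    split_ifs <;> fun_prop
  have h2 : Measurable fun r : (ℕ → Bool) × Seed =>
      splice (Finset.range (m + l + N)) (template (m + l) c j r.1) r.2.1 :=
    (measurable_splice _).comp (h1.prodMk measurable_snd.fst)
  exact h2.prodMk measurable_snd.snd

lemma map_place_le {m : ℕ} (N l : ℕ) (c : Cell m) (j : ℕ) {q : Measure unitInterval}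
    [IsProbabilityMeasure q] {K : ℝ≥0∞} (hq : q ≤ K • volume) :
    (coin.prod (coin.prod q)).map (fun r => place N l c j r.1 r.2) ≤
      ((2 : ℝ≥0∞) ^ (m + N) * K) • seedMeasure := by
  set B := Finset.range m ∪ Finset.Ico (m + l) (m + l + N) with hB
  set t := template (m + l) c j fun _ => false with ht
  have hs : Measurable fun r : (ℕ → Bool) × Seed => (splice (Set.Iio (m + l)) r.1 r.2.1, r.2.2) := by
    have h1 : Measurable fun r : (ℕ → Bool) × Seed => splice (Set.Iio (m + l)) r.1 r.2.1 :=
      (measurable_splice _).comp (measurable_fst.prodMk measurable_snd.fst)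
    exact h1.prodMk measurable_snd.snd
  have hmap : (coin.prod (coin.prod q)).map
      (fun r => (splice (Set.Iio (m + l)) r.1 r.2.1, r.2.2)) = coin.prod q := by
    have h1 := ((measurePreserving_prodAssoc coin coin q).symm MeasurableEquiv.prodAssoc).map_eq
    have h2 := Measure.map_prod_map (coin.prod coin) q (measurable_splice (Set.Iio (m + l)))
      measurable_id
    rw [map_splice_coin, Measure.map_id, ← h1,
      Measure.map_map ((measurable_splice _).prodMap measurable_id)
        (MeasurableEquiv.measurable _)] at h2
    exact h2.symm
  have ho : Measurable fun s : Seed => (splice B t s.1, s.2) := by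
    have h1 : Measurable fun s : Seed => splice B t s.1 :=
      (measurable_splice _).comp (measurable_const.prodMk measurable_fst)
    exact h1.prodMk measurable_snd
  have e : (fun r : (ℕ → Bool) × Seed => place N l c j r.1 r.2) =
      (fun s : Seed => (splice B t s.1, s.2)) ∘
        fun r => (splice (Set.Iio (m + l)) r.1 r.2.1, r.2.2) := by
    funext r
    rw [place_eq_overwrite, template_eq_of N l c j r.1 fun _ => false]
    rfl
  rw [e, ← Measure.map_map ho hs, hmap]
  refine (map_overwrite_seed_le hq B t).trans (Measure.le_iff.2 fun S _ => ?_)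
  rw [Measure.smul_apply, Measure.smul_apply, smul_eq_mul, smul_eq_mul]
  have hc : B.card ≤ m + N := (Finset.card_union_le _ _).trans (by simp)
  gcongr
  exact one_le_two

lemma map_place_fixed_le {m : ℕ} (N l : ℕ) (c : Cell m) (j : ℕ) (z : ℕ → Bool)
    {q : Measure unitInterval} [IsProbabilityMeasure q] {K : ℝ≥0∞} (hq : q ≤ K • volume) :
    (coin.prod q).map (place N l c j z) ≤ ((2 : ℝ≥0∞) ^ (m + l + N) * K) • seedMeasure := by
  have := map_overwrite_seed_le hq (Finset.range (m + l + N)) (template (m + l) c j z)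
  rwa [Finset.card_range] at this

lemma tendsto_place {m : ℕ} (N : ℕ) (c : Cell m) (j : ℕ) (z : ℕ → Bool) (s : Seed) :
    Tendsto (fun l => place N l c j z s) atTop (nhds (inCell c (z, s.2))) := by
  have h : Tendsto (fun l => (place N l c j z s).1) atTop
      (nhds (splice (Set.Iio m) c.pos z)) := by
    refine tendsto_pi_nhds.2 fun i => tendsto_const_nhds.congr' ?_
    filter_upwards [eventually_gt_atTop i] with l hl
    simp only [place, splice, template, Finset.mem_coe, Finset.mem_range, Set.mem_Iio]
    split_ifs <;> first | rfl | omega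
  exact h.prodMk_nhds tendsto_const_nhds

lemma map_inCell_le {m : ℕ} (c : Cell m) {q : Measure unitInterval} [IsProbabilityMeasure q]
    {K : ℝ≥0∞} (hq : q ≤ K • volume) (N : ℕ) :
    (coin.prod q).map (inCell c) ≤ ((2 : ℝ≥0∞) ^ (m + N) * K) • seedMeasure := by
  have h := map_overwrite_seed_le hq (Finset.range m) c.pos
  have e : (fun s : Seed => (splice (Finset.range m) c.pos s.1, s.2)) = inCell c := by
    funext s
    simp [inCell]
  rw [e] at h
  refine h.trans (Measure.le_iff.2 fun S _ => ?_)
  rw [Measure.smul_apply, Measure.smul_apply, smul_eq_mul, smul_eq_mul, Finset.card_range]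
  gcongr
  · exact one_le_two
  · exact Nat.le_add_right _ _

lemma lexLT_of_template {n m l : ℕ} {c d : Cell m} {u v : ℕ} (huv : u < v) (hv : v < n)
    (hc : ∀ i : Fin m, c.1 i = posBits n u i) (hd : ∀ i : Fin m, d.1 i = posBits n v i)
    {z : (Fin m → Bool) → ℕ → Bool} {a b : ℕ → Bool}
    (ha : ∀ i < m + l + n, a i = template (m + l) c u (z c.1) i)
    (hb : ∀ i < m + l + n, b i = template (m + l) d v (z d.1) i) : LexLT a b := by
  have hcp : ∀ i < m, c.pos i = posBits n u i := fun i hi => by simp [Cell.pos, hi, hc]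
  have hdp : ∀ i < m, d.pos i = posBits n v i := fun i hi => by simp [Cell.pos, hi, hd]
  rcases posBits_prefix_or huv hv m with h | ⟨r, hr, h1, h2, h3⟩
  · have hcd : c.1 = d.1 := funext fun i => by rw [hc, hd, h i i.2]
    refine ⟨m + l + u, fun i hi => ?_, ?_, ?_⟩
    · rw [ha i (by omega), hb i (by omega)]
      unfold template
      split_ifs with i1 i2
      · rw [hcp i i1, hdp i i1, h i i1]
      · rw [hcd]
      · simp only [hi, true_eq_decide_iff, decide_true]
        omega
    · rw [ha _ (by omega)]
      unfold template
      rw [if_neg (by omega), if_neg (by omega)]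
      simp
    · rw [hb _ (by omega)]
      unfold template
      rw [if_neg (by omega), if_neg (by omega)]
      simpa using huv
  · refine ⟨r, fun i hi => ?_, ?_, ?_⟩
    · rw [ha i (by omega), hb i (by omega), template, template, if_pos (by omega),
        if_pos (by omega), hcp i (by omega), hdp i (by omega), h1 i hi]
    · rw [ha r (by omega), template, if_pos hr, hcp r hr, h2]
    · rw [hb r (by omega), template, if_pos hr, hdp r hr, h3]

lemma tendsto_integral_place {m : ℕ} {Q : Cell m → Measure unitInterval}
    [∀ c, IsProbabilityMeasure (Q c)] {K : ℝ≥0∞} (hK : K ≠ ∞) (hQK : ∀ c, Q c ≤ K • volume)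
    {w : Seed × Seed → ℝ} (hw : Measurable w) (hw1 : ∀ p, w p ∈ Set.Icc (0 : ℝ) 1)
    (N : ℕ) (c d : Cell m) (i j : ℕ) :
    Tendsto (fun l => ∫ r, w (place N l c i r.1.1 r.1.2, place N l d j r.2.1 r.2.2)
        ∂((coin.prod (coin.prod (Q c))).prod (coin.prod (coin.prod (Q d)))))
      atTop (nhds (cellMean Q w c d)) := by
  set σ := (coin.prod (coin.prod (Q c))).prod (coin.prod (coin.prod (Q d))) with hσ
  set C := (2 : ℝ≥0∞) ^ (m + N) * K with hC
  have hCt : C ≠ ∞ := ENNReal.mul_ne_top (by simp) hK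
  have hT : ∀ l, Measurable fun r : ((ℕ → Bool) × Seed) × ((ℕ → Bool) × Seed) =>
      (place N l c i r.1.1 r.1.2, place N l d j r.2.1 r.2.2) := fun l =>
    (measurable_place N l c i).prodMap (measurable_place N l d j)
  have hp : Measurable fun r : (ℕ → Bool) × Seed => (r.1, r.2.2) := by fun_prop
  have hi : ∀ c : Cell m, Measurable fun r : (ℕ → Bool) × Seed => inCell c (r.1, r.2.2) := fun c =>
    (measurable_inCell c).comp hp
  have hT' : Measurable fun r : ((ℕ → Bool) × Seed) × ((ℕ → Bool) × Seed) =>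
      (inCell c (r.1.1, r.1.2.2), inCell d (r.2.1, r.2.2.2)) := (hi c).prodMap (hi d)
  have hpm : ∀ c, (coin.prod (coin.prod (Q c))).map (fun r => (r.1, r.2.2)) = coin.prod (Q c) :=
    fun c => ((MeasurePreserving.id coin).prod
      (measurePreserving_snd (μ := coin) (ν := Q c))).map_eq
  have him : ∀ c : Cell m, (coin.prod (coin.prod (Q c))).map
      (fun r => inCell c (r.1, r.2.2)) ≤ C • seedMeasure := fun c => by
    have h := map_inCell_le c (hQK c) N
    rw [← hpm c, Measure.map_map (measurable_inCell c) hp] at h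
    exact h
  have hprod : (C • seedMeasure).prod (C • seedMeasure) =
      (C * C) • seedMeasure.prod seedMeasure := by
    rw [Measure.prod_smul_left, Measure.prod_smul_right, smul_smul]
  have hlim := tendsto_integral_abs_comp_sub (ρ := seedMeasure.prod seedMeasure) (σ := σ)
    (T := fun l r => (place N l c i r.1.1 r.1.2, place N l d j r.2.1 r.2.2))
    (T' := fun r => (inCell c (r.1.1, r.1.2.2), inCell d (r.2.1, r.2.2.2))) hT hT'
    (fun r => (tendsto_place N c i _ _).prodMk_nhds (tendsto_place N d j _ _))
    (ENNReal.mul_ne_top hCt hCt) (fun l => by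
      have h := Measure.map_prod_map (coin.prod (coin.prod (Q c))) (coin.prod (coin.prod (Q d)))
        (measurable_place N l c i) (measurable_place N l d j)
      refine (le_of_eq h.symm).trans ?_
      rw [← hprod]
      exact Measure.prod_mono (map_place_le N l c i (hQK c)) (map_place_le N l d j (hQK d)))
    (by
      have h := Measure.map_prod_map (coin.prod (coin.prod (Q c))) (coin.prod (coin.prod (Q d)))
        (hi c) (hi d)
      refine (le_of_eq h.symm).trans ?_
      rw [← hprod]
      exact Measure.prod_mono (him c) (him d)) hw hw1
  have hmean : ∫ r, w (inCell c (r.1.1, r.1.2.2), inCell d (r.2.1, r.2.2.2)) ∂σ =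
      cellMean Q w c d := by
    have h := Measure.map_prod_map (coin.prod (coin.prod (Q c))) (coin.prod (coin.prod (Q d))) hp hp
    rw [hpm, hpm] at h
    rw [cellMean, h, integral_map (f := fun q => w (inCell c q.1, inCell d q.2))
      (hp.prodMap hp).aemeasurable (hw.comp
        ((measurable_inCell c).prodMap (measurable_inCell d))).aestronglyMeasurable]
    rfl
  have h_int : ∀ {T : ((ℕ → Bool) × Seed) × ((ℕ → Bool) × Seed) → Seed × Seed}, Measurable T →
      Integrable (fun r => w (T r)) σ := fun hT =>
    Integrable.of_bound (hw.comp hT).aestronglyMeasurable 1 (ae_of_all _ fun r => by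
      rw [Real.norm_eq_abs, abs_of_nonneg (hw1 _).1]; exact (hw1 _).2)
  rw [← hmean, tendsto_iff_dist_tendsto_zero]
  refine squeeze_zero (fun _ => dist_nonneg) (fun l => ?_) hlim
  rw [Real.dist_eq, ← integral_sub (h_int (hT l)) (h_int hT')]
  exact abs_integral_le_integral_abs

section Sample

variable {m N : ℕ} {H : ∀ n, Set (SimpleGraph (Fin n))} {c : Fin N → Cell m}
  {Q : Cell m → Measure unitInterval} [∀ c, IsProbabilityMeasure (Q c)]

lemma map_pair_sample {u v : Fin N} (huv : (c u).1 ≠ (c v).1) :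
    ((Measure.pi fun _ : Fin m → Bool => coin).prod
      (Measure.pi fun v => coin.prod (Q (c v)))).map
      (fun r => ((r.1 (c u).1, r.2 u), (r.1 (c v).1, r.2 v))) =
    (coin.prod (coin.prod (Q (c u)))).prod (coin.prod (coin.prod (Q (c v)))) := by
  have huv' : u ≠ v := fun h => huv (h ▸ rfl)
  have h1 := map_pair_pi (fun _ : Fin m → Bool => coin) huv
  have h2 := map_pair_pi (fun v => coin.prod (Q (c v))) huv'
  have m1 : Measurable fun ξ : (Fin m → Bool) → ℕ → Bool => (ξ (c u).1, ξ (c v).1) := by fun_prop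
  have m2 : Measurable fun s : Fin N → Seed => (s u, s v) := by fun_prop
  have h3 := Measure.map_prod_map (Measure.pi fun _ : Fin m → Bool => coin)
    (Measure.pi fun v => coin.prod (Q (c v))) m1 m2
  rw [h1, h2] at h3
  rw [← map_prod_prod_comm, h3, Measure.map_map (by fun_prop) (m1.prodMap m2)]
  rfl

lemma ae_sample_mem {K : ℝ≥0∞} (hK0 : K ≠ 0) (hK : K ≠ ∞) (hQK : ∀ c, Q c ≤ K • volume) (l : ℕ)
    (ξ : (Fin m → Bool) → ℕ → Bool) {P : (Fin N → Seed) → Prop}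
    (hP : ∀ᵐ p ∂(Measure.pi fun _ : Fin N => seedMeasure), P p) :
    ∀ᵐ s ∂(Measure.pi fun v => coin.prod (Q (c v))),
      P fun v => place N l (c v) v (ξ (c v).1) (s v) := by
  have hm : ∀ v : Fin N, Measurable (place N l (c v) v (ξ (c v).1)) := fun v =>
    (measurable_place N l (c v) v).comp (measurable_const.prodMk measurable_id)
  have : ∀ v : Fin N, IsProbabilityMeasure
      ((coin.prod (Q (c v))).map (place N l (c v) v (ξ (c v).1))) := fun v =>
    Measure.isProbabilityMeasure_map (hm v).aemeasurable
  have h1 := pi_le_smul_pi (ν := fun v : Fin N =>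
      (coin.prod (Q (c v))).map (place N l (c v) v (ξ (c v).1))) (ρ := seedMeasure)
    (K := (2 : ℝ≥0∞) ^ (m + l + N) * K) (mul_ne_zero (by simp) hK0)
    (ENNReal.mul_ne_top (by simp) hK) fun v => map_place_fixed_le N l (c v) v _ (hQK _)
  have h2 : Measure.pi (fun v : Fin N =>
      (coin.prod (Q (c v))).map (place N l (c v) v (ξ (c v).1))) =
      (Measure.pi fun v => coin.prod (Q (c v))).map
        fun s v => place N l (c v) v (ξ (c v).1) (s v) :=
    (Measure.pi_map_pi fun v => (hm v).aemeasurable).symm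
  rw [h2] at h1
  refine ae_of_ae_map (measurable_pi_iff.2 fun v =>
    (hm v).comp (measurable_pi_apply v)).aemeasurable ?_
  exact (Measure.absolutelyContinuous_of_le_smul h1).ae_le hP

end Sample

lemma exists_graph_of_zeroInd {N : ℕ} (G : SimpleGraph (Fin N)) {z : Fin N → Fin N → ℝ}
    (hz : ∀ u v, z u v ∈ Set.Icc (0 : ℝ) 1) :
    ∃ F : SimpleGraph (Fin N), ∀ u v, u < v → 0 < edgeWeight (F.Adj u v) (z u v) ∧
      (¬ (G.Adj u v ↔ F.Adj u v) → zeroInd (G.Adj u v) (z u v) = 1) := by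
  set R : Fin N → Fin N → Prop := fun u v =>
    if edgeWeight (G.Adj u v) (z u v) = 0 then ¬ G.Adj u v else G.Adj u v with hR
  refine ⟨⟨fun u v => (u < v ∧ R u v) ∨ (v < u ∧ R v u), ⟨fun u v h => Or.symm h⟩, ⟨fun u h => by
    simp at h⟩⟩, fun u v huv => ?_⟩
  have hF : ((u < v ∧ R u v) ∨ (v < u ∧ R v u)) ↔ R u v := by
    simp [huv, huv.not_gt]
  simp only [hF]
  by_cases h0 : edgeWeight (G.Adj u v) (z u v) = 0
  · have h1 : R u v ↔ ¬ G.Adj u v := by simp [hR, h0]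
    simp only [h1, zeroInd, h0, if_true, implies_true, and_true]
    unfold edgeWeight at h0 ⊢
    by_cases hG : G.Adj u v
    · simp only [hG, if_true, not_true_eq_false, if_false] at h0 ⊢
      linarith
    · simp only [hG, if_false, not_false_eq_true, if_true] at h0 ⊢
      linarith
  · have h1 : R u v ↔ G.Adj u v := by simp [hR, h0]
    simp only [h1]
    exact ⟨(edgeWeight_mem _ (hz u v)).1.lt_of_ne' h0, fun h => absurd trivial h⟩

section Sample

variable {m N : ℕ} {H : ∀ n, Set (SimpleGraph (Fin n))} {c : Fin N → Cell m}
  {Q : Cell m → Measure unitInterval} [∀ c, IsProbabilityMeasure (Q c)]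

lemma exists_mem_close (hc : ∀ v (i : Fin m), (c v).1 i = posBits N v i) {K : ℝ≥0∞} (hK0 : K ≠ 0)
    (hK : K ≠ ∞) (hQK : ∀ c, Q c ≤ K • volume) {w : Seed × Seed → ℝ} (hw : Measurable w)
    (hw1 : ∀ p, w p ∈ Set.Icc (0 : ℝ) 1)
    (hmem : ∀ D : Fin N → Set (ℕ → Bool), (∀ i, IsClopen (D i)) →
      (∀ i j, i < j → ∀ a ∈ D i, ∀ b ∈ D j, LexLT a b) →
      ∀ᵐ p ∂(Measure.pi fun _ : Fin N => seedMeasure), (∀ i, (p i).1 ∈ D i) →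
        ∀ F : SimpleGraph (Fin N),
          (∀ i j, i < j → 0 < edgeWeight (F.Adj i j) (w (p i, p j))) → F ∈ H N)
    (G : SimpleGraph (Fin N)) {δ : ℝ} (hδ : 0 < δ) :
    ∃ F ∈ H N, ((Finset.univ.filter fun p : Fin N × Fin N =>
        ¬ (G.Adj p.1 p.2 ↔ F.Adj p.1 p.2)).card : ℝ) ≤
      2 * (∑ p : Fin N × Fin N,
        cellMean Q (fun q => zeroInd (G.Adj p.1 p.2) (w q)) (c p.1) (c p.2) + δ) +
      (Finset.univ.filter fun p : Fin N × Fin N =>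
        ∀ i < m, posBits N p.1 i = posBits N p.2 i).card := by
  set E : Finset (Fin N × Fin N) :=
    Finset.univ.filter fun e => e.1 < e.2 ∧ (c e.1).1 ≠ (c e.2).1 with hE
  set f : Fin N × Fin N → Seed × Seed → ℝ := fun e q => zeroInd (G.Adj e.1 e.2) (w q) with hf
  have hfm : ∀ e, Measurable (f e) := fun e => (measurable_zeroInd _).comp hw
  have hf1 : ∀ e q, f e q ∈ Set.Icc (0 : ℝ) 1 := fun e q => zeroInd_mem _ _
  set A := Measure.pi fun _ : Fin m → Bool => coin with hA
  set B := Measure.pi fun v : Fin N => coin.prod (Q (c v)) with hB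
  set T : ℕ → ((Fin m → Bool) → ℕ → Bool) → (Fin N → Seed) → Fin N → Seed :=
    fun l ξ s v => place N l (c v) v (ξ (c v).1) (s v) with hT
  have hpairm : ∀ e : Fin N × Fin N, Measurable fun r : ((Fin m → Bool) → ℕ → Bool) ×
      (Fin N → Seed) => ((r.1 (c e.1).1, r.2 e.1), (r.1 (c e.2).1, r.2 e.2)) := fun e => by
    fun_prop
  have hplm : ∀ l (e : Fin N × Fin N), Measurable fun r : ((ℕ → Bool) × Seed) × ((ℕ → Bool) × Seed) =>
      f e (place N l (c e.1) e.1 r.1.1 r.1.2, place N l (c e.2) e.2 r.2.1 r.2.2) := fun l e =>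
    (hfm e).comp ((measurable_place N l (c e.1) e.1).prodMap (measurable_place N l (c e.2) e.2))
  have hfT : ∀ l e, Measurable fun r : ((Fin m → Bool) → ℕ → Bool) × (Fin N → Seed) =>
      f e (T l r.1 r.2 e.1, T l r.1 r.2 e.2) := fun l e => (hplm l e).comp (hpairm e)
  have h_int : ∀ l e, Integrable (fun r : ((Fin m → Bool) → ℕ → Bool) × (Fin N → Seed) =>
      f e (T l r.1 r.2 e.1, T l r.1 r.2 e.2)) (A.prod B) := fun l e =>
    Integrable.of_bound (hfT l e).aestronglyMeasurable 1 (ae_of_all _ fun r => by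
      rw [Real.norm_eq_abs, abs_of_nonneg (hf1 e _).1]; exact (hf1 e _).2)
  set X : ℕ → ((Fin m → Bool) → ℕ → Bool) × (Fin N → Seed) → ℝ := fun l r =>
    ∑ e ∈ E, f e (T l r.1 r.2 e.1, T l r.1 r.2 e.2) with hX
  have hXi : ∀ l, Integrable (X l) (A.prod B) := fun l => integrable_finsetSum _ fun e _ => h_int l e
  set S := ∑ p : Fin N × Fin N, cellMean Q (f p) (c p.1) (c p.2) with hS
  have hlim : Tendsto (fun l => ∫ r, X l r ∂(A.prod B)) atTop
      (nhds (∑ e ∈ E, cellMean Q (f e) (c e.1) (c e.2))) := by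
    simp only [hX]
    simp_rw [integral_finsetSum E fun e _ => h_int _ e]
    refine tendsto_finsetSum _ fun e he => ?_
    have hne : (c e.1).1 ≠ (c e.2).1 := (Finset.mem_filter.1 he).2.2
    refine (tendsto_integral_place hK hQK (hfm e) (hf1 e) N (c e.1) (c e.2) e.1 e.2).congr
      fun l => ?_
    rw [← map_pair_sample hne, integral_map (hpairm e).aemeasurable (hplm l e).aestronglyMeasurable]
  have hES : ∑ e ∈ E, cellMean Q (f e) (c e.1) (c e.2) ≤ S :=
    Finset.sum_le_sum_of_subset_of_nonneg (Finset.subset_univ _) fun e _ _ =>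
      (cellMean_mem (hf1 e) _ _).1
  obtain ⟨l, hl⟩ := (hlim.eventually (gt_mem_nhds (by linarith :
    ∑ e ∈ E, cellMean Q (f e) (c e.1) (c e.2) < S + δ))).exists
  obtain ⟨ξ, hξi, hξ⟩ : ∃ ξ, Integrable (fun s => X l (ξ, s)) B ∧ ∫ s, X l (ξ, s) ∂B ≤ S + δ := by
    have h1 := (hXi l).integral_prod_left
    have h0 : A {ξ | ¬ Integrable (fun s => X l (ξ, s)) B} = 0 := (hXi l).prod_right_ae
    obtain ⟨ξ, hξ0, hξ⟩ := exists_notMem_null_le_integral h1 h0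
    rw [← integral_prod _ (hXi l)] at hξ
    exact ⟨ξ, not_not.1 hξ0, hξ.trans hl.le⟩
  have hae := ae_sample_mem (c := c) hK0 hK hQK l ξ (hmem
    (fun v => {a | ∀ i < m + l + N, a i = template (m + l) (c v) v (ξ (c v).1) i})
    (fun v => isClopen_cylinder _ _) fun u v huv a ha b hb =>
      lexLT_of_template huv v.2 (hc u) (hc v) ha hb)
  obtain ⟨s, hs0, hs⟩ := exists_notMem_null_le_integral hξi hae
  have hs1 := not_not.1 hs0
  obtain ⟨F, hF⟩ := exists_graph_of_zeroInd G (z := fun u v => w (T l ξ s u, T l ξ s v))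
    fun u v => hw1 _
  refine ⟨F, hs1 (fun v i hi => ?_) F fun u v huv => (hF u v huv).1, ?_⟩
  · simp [place, splice, hi]
  set I : Fin N × Fin N → ℝ := fun e => if e ∈ E then f e (T l ξ s e.1, T l ξ s e.2) else 0 with hI
  have hI0 : ∀ e, 0 ≤ I e := fun e => by
    simp only [hI]; split_ifs; exacts [(hf1 _ _).1, le_rfl]
  have hIsum : ∑ e, I e = X l (ξ, s) := by
    simp only [hI, hX, Finset.sum_ite_mem, Finset.univ_inter]
  have hIswap : ∑ e : Fin N × Fin N, I e.swap = X l (ξ, s) := by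
    rw [← hIsum]
    exact Fintype.sum_equiv (Equiv.prodComm _ _) _ _ fun _ => rfl
  have hlt : ∀ u v, u < v → ¬ (G.Adj u v ↔ F.Adj u v) →
      (¬ ∀ i < m, posBits N u i = posBits N v i) → 1 ≤ I (u, v) := fun u v huv hd hpre => by
    have hmemE : (u, v) ∈ E := by
      refine Finset.mem_filter.2 ⟨Finset.mem_univ _, huv, fun h => hpre fun i hi => ?_⟩
      rw [← hc u ⟨i, hi⟩, ← hc v ⟨i, hi⟩, h]
    simp only [hI, if_pos hmemE, hf]
    exact ((hF u v huv).2 hd).ge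
  have hpt : ∀ p : Fin N × Fin N, (if ¬ (G.Adj p.1 p.2 ↔ F.Adj p.1 p.2) then (1 : ℝ) else 0) ≤
      (I p + I p.swap) + if ∀ i < m, posBits N p.1 i = posBits N p.2 i then (1 : ℝ) else 0 := by
    rintro ⟨u, v⟩
    have h1 := hI0 (u, v)
    have h2 := hI0 (v, u)
    simp only [Prod.swap_prod_mk]
    by_cases hpre : ∀ i < m, posBits N u i = posBits N v i
    · rw [if_pos hpre]
      split_ifs <;> linarith
    rw [if_neg hpre]
    by_cases hd : G.Adj u v ↔ F.Adj u v
    · rw [if_neg (not_not.2 hd)]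
      linarith
    rw [if_pos hd]
    rcases lt_trichotomy u v with h | h | h
    · linarith [hlt u v h hd hpre]
    · exact absurd (fun i _ => by rw [h]) hpre
    · rw [G.adj_comm, F.adj_comm] at hd
      linarith [hlt v u h hd fun h' => hpre fun i hi => (h' i hi).symm]
  have hsum := Finset.sum_le_sum fun p (_ : p ∈ Finset.univ) => hpt p
  rw [Finset.sum_add_distrib, Finset.sum_add_distrib, hIsum, hIswap, Finset.sum_boole,
    Finset.sum_boole] at hsum
  linarith

end Sample

section Limit

variable {n : ℕ → ℕ} [∀ k, NeZero (n k)] {G : ∀ k, SimpleGraph (Fin (n k))}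
  {x : ∀ k, Fin (n k) → ℕ → Bool}

lemma LimitObject.tendsto_edgeWeight (L : LimitObject G x) (b : Prop) (h : C(Label × Label, ℝ)) :
    Tendsto (fun k => (∑ u, ∑ v, edgeWeight b (adjInd (G k) u v) * h (L.φ k u, L.φ k v)) /
      (n k : ℝ) ^ 2) (hyperfilter ℕ : Filter ℕ)
      (nhds (∫ p, edgeWeight b (L.W p) * h p ∂((L.μ : Measure Label).prod L.μ))) := by
  by_cases hb : b
  · simpa only [edgeWeight, hb, if_true] using L.edge h
  · have h1 := (tendsto_pair_average L.lim h).sub (L.edge h)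
    have hi : Integrable (fun p => h p) ((L.μ : Measure Label).prod L.μ) :=
      (BoundedContinuousFunction.mkOfCompact h).integrable _
    have hWi : Integrable (fun p => L.W p * h p) ((L.μ : Measure Label).prod L.μ) :=
      hi.bdd_mul L.measurable_W.aestronglyMeasurable (ae_of_all _ fun p => by
        rw [Real.norm_eq_abs, abs_of_nonneg (L.W_mem p).1]; exact (L.W_mem p).2)
    rw [← integral_sub hi hWi] at h1
    simp only [edgeWeight, hb, if_false, sub_mul, one_mul]
    refine h1.congr fun k => ?_
    simp only [Finset.sum_sub_distrib, sub_div]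

end Limit

lemma exists_editDist_lt_of_badCount_tendsto {H : ∀ n, Set (SimpleGraph (Fin n))} {ε : ℝ}
    (hε : 0 < ε) {n : ℕ → ℕ} (hn : ∀ k, k + 1 ≤ n k) (G : ∀ k, SimpleGraph (Fin (n k)))
    (hbad : ∀ N, Tendsto (fun k => (badCount H (G k) N : ℝ) / (n k : ℝ) ^ N) atTop (nhds 0)) :
    ∃ k, ∃ F ∈ H (n k), editDist (G k) F < ε := by
  have hn0 : ∀ k, NeZero (n k) := fun k => ⟨by have := hn k; omega⟩
  obtain ⟨L⟩ := nonempty_limitObject G fun k v => posBits (n k) v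
  set μ : Measure Label := (L.μ : Measure Label) with hμ
  obtain ⟨g, hgm, hg, hgμ⟩ := exists_seed_representation μ (L.map_fst_eq_coin hn)
  set η := ε / 40 with hη
  have hη0 : 0 < η := by positivity
  have hpow : ∀ᶠ m : ℕ in atTop, ((1 : ℝ) / 2) ^ m < η :=
    (tendsto_pow_atTop_nhds_zero_of_lt_one (by norm_num) (by norm_num)).eventually
      (gt_mem_nhds hη0)
  obtain ⟨m, hm, hmη⟩ :=
    ((exists_zero_bound L.measurable_W L.W_mem hgm hg hgμ hη0).and hpow).exists
  obtain ⟨Q, hQ1, hQ, K, hK0, hK, hQK⟩ := exists_cell_law fun ω => cell m (g ω)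
  set w : Seed × Seed → ℝ := fun q => L.W (g q.1, g q.2) with hwdef
  have hgg : Measurable fun q : Seed × Seed => (g q.1, g q.2) := hgm.prodMap hgm
  have hw : Measurable w := L.measurable_W.comp hgg
  set Φ : Prop → Cell m → Cell m → ℝ := fun b => cellMean Q fun q => zeroInd b (w q) with hΦ
  have hev : ∀ b, ∀ᶠ k in (hyperfilter ℕ : Filter ℕ),
      (∑ u, ∑ v, edgeWeight b (adjInd (G k) u v) * Φ b (cell m (L.φ k u)) (cell m (L.φ k v))) /
        (n k : ℝ) ^ 2 < 4 * η := fun b => by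
    have hc : Continuous fun p : Label × Label => Φ b (cell m p.1) (cell m p.2) := by
      have h1 : Continuous fun q : Cell m × Cell m => Φ b q.1 q.2 := continuous_of_discreteTopology
      exact h1.comp ((continuous_cell m).prodMap (continuous_cell m))
    refine (L.tendsto_edgeWeight b ⟨_, hc⟩).eventually (gt_mem_nhds ?_)
    exact (hm Q hQ1 hQ b).trans_lt (by linarith)
  obtain ⟨r, hr⟩ := exists_nat_gt (1 / η)
  obtain ⟨k, hkT, hkF, hkr⟩ := ((hev True).and ((hev False).and
    (Nat.hyperfilter_le_atTop (eventually_ge_atTop r)))).exists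
  have hnpos : 0 < n k := by have := hn k; omega
  have hnR : (0 : ℝ) < n k := by exact_mod_cast hnpos
  have hn2 : (0 : ℝ) < (n k : ℝ) ^ 2 := by positivity
  have hmem : ∀ D : Fin (n k) → Set (ℕ → Bool), (∀ i, IsClopen (D i)) →
      (∀ i j, i < j → ∀ a ∈ D i, ∀ b ∈ D j, LexLT a b) →
      ∀ᵐ p ∂(Measure.pi fun _ : Fin (n k) => seedMeasure), (∀ i, (p i).1 ∈ D i) →
        ∀ F : SimpleGraph (Fin (n k)),
          (∀ i j, i < j → 0 < edgeWeight (F.Adj i j) (w (p i, p j))) → F ∈ H (n k) := by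
    intro D hD hlex
    have h1 := L.ae_mem (fun k u v h => lt_of_lexLT_posBits u.2 v.2 h) (hbad (n k)) D hD hlex
    have : ∀ _ : Fin (n k), IsProbabilityMeasure (seedMeasure.map g) := fun _ =>
      Measure.isProbabilityMeasure_map hgm.aemeasurable
    have h2 := Measure.pi_map_pi (ι := Fin (n k)) (μ := fun _ => seedMeasure) (f := fun _ => g)
      fun _ => hgm.aemeasurable
    rw [hgμ] at h2
    rw [← hμ, ← h2] at h1
    filter_upwards [ae_of_ae_map (measurable_pi_iff.2 fun v =>
      hgm.comp (measurable_pi_apply v)).aemeasurable h1] with p hp hpD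
    exact hp fun i => show (g (p i)).1 ∈ D i by rw [hg]; exact hpD i
  obtain ⟨F, hF, hcount⟩ := exists_mem_close (c := fun v => cell m (L.φ k v))
    (fun v i => by simp only [cell, L.fst_φ]) hK0 hK hQK hw (fun q => L.W_mem _) hmem (G k)
    (mul_pos hη0 hn2)
  refine ⟨k, F, hF, ?_⟩
  have hsum : ∑ p : Fin (n k) × Fin (n k), cellMean Q (fun q => zeroInd ((G k).Adj p.1 p.2) (w q))
      (cell m (L.φ k p.1)) (cell m (L.φ k p.2)) =
      (∑ u, ∑ v, edgeWeight True (adjInd (G k) u v) *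
        Φ True (cell m (L.φ k u)) (cell m (L.φ k v))) +
      ∑ u, ∑ v, edgeWeight False (adjInd (G k) u v) *
        Φ False (cell m (L.φ k u)) (cell m (L.φ k v)) := by
    rw [Fintype.sum_prod_type]
    simp only [← Finset.sum_add_distrib]
    refine Finset.sum_congr rfl fun u _ => Finset.sum_congr rfl fun v _ => ?_
    by_cases h : (G k).Adj u v <;> simp [h, adjInd, edgeWeight, hΦ]
  rw [div_lt_iff₀ hn2] at hkT hkF
  have hpre := card_same_prefix_le (n := n k) (m := m) hnpos
  have hbig : (n k : ℝ) * (n k / 2 ^ m + 1) ≤ 2 * (η * (n k : ℝ) ^ 2) := by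
    have h1 : (n k : ℝ) / 2 ^ m ≤ n k * η := by
      rw [div_eq_mul_one_div, ← one_div_pow]
      exact mul_le_mul_of_nonneg_left hmη.le hnR.le
    have h2 : 1 ≤ n k * η := by
      have h3 : (r : ℝ) ≤ n k := by exact_mod_cast (hkr.trans (by have := hn k; omega))
      exact ((div_lt_iff₀ hη0).1 (hr.trans_le h3)).le
    nlinarith
  rw [editDist, div_lt_iff₀ hn2]
  have hε40 : ε = 40 * η := by rw [hη]; ring
  have : 0 < η * (n k : ℝ) ^ 2 := mul_pos hη0 hn2
  rw [hε40]
  rw [hsum] at hcount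
  linarith

/-- Ordered removal lemma: for every hereditary property `ℋ` (nonempty at every size)
and `ε, c > 0` there is `k` such that for every ordered graph `G` on `n ≥ k` vertices
that is `ε`-far from `ℋ`, the induced subgraph on a uniformly random `k`-element vertex
subset is not in `ℋ` with probability at least `1 - c`. -/
theorem ordered_removal_lemma
    (H : ∀ n, Set (SimpleGraph (Fin n))) (hH : Hereditary H)
    (hne : ∀ n : ℕ, 1 ≤ n → (H n).Nonempty)
    (ε c : ℝ) (hε : 0 < ε) (hc : 0 < c) :
    ∃ k : ℕ, 1 ≤ k ∧ ∀ n : ℕ, k ≤ n → ∀ G : SimpleGraph (Fin n),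
      ε ≤ distToProp G (H n) →
      1 - c ≤
        (((Finset.powersetCard k (Finset.univ : Finset (Fin n))).filter
            (fun S : Finset (Fin n) => inducedSG G k S ∉ H k)).card : ℝ) /
          (n.choose k : ℝ) := by
  exact removal_of_exists_badCount hH hc (exists_badCount_of_far hH fun n hn G hbad =>
    exists_editDist_lt_of_badCount_tendsto hε hn G hbad)
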